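/- arXiv:2508.17217 — 2 statements merged into one kernel-verified Lean document; each statement's English description precedes it below -/
import Mathlib

section
/- Fix 0 < α < 1/2, 0 < κ < 1/2, 0 < β < ακ/41, ε > 0, a constant A1 > 0, and functions A2, A3 : (0,∞) → (0,∞). Then there exist a constant C > 0 and a threshold x0 such that for all x ≥ x0, every nonnegative multiplicative f in M(β) relative to x, every X, Y with x^{κ/2} ≤ Y ≤ X ≤ x, every k with 1 ≤ k < Y^{1-α}, and every a with gcd(a,k) = 1: ∑_{X ≤ t ≤ X+Y, t ≡ a (mod k), t J-rough} f(t) ≤ C · (Y/(φ(k) (log x)^{1−ε})) · exp(∑_{J < p ≤ x prime, p ∤ k} f(p)/p), where J = (log log x)^{1−β}. -/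
open Finset

noncomputable section

/-- A nonnegative multiplicative function: `f ≥ 0`, `f 1 = 1`, and
`f (m n) = f m * f n` whenever `gcd (m, n) = 1`. -/
def MultNonneg (f : ℕ → ℝ) : Prop :=
  (∀ n, 0 ≤ f n) ∧ f 1 = 1 ∧ ∀ m n : ℕ, Nat.Coprime m n → f (m * n) = f m * f n

/-- The class `M(β)` relative to `x`:
(Condition 1) `f (p^l) ≤ A1^l * (log log x)^(β l)` for all primes `p` and `l ≥ 1`;
(Condition 2) `f n ≤ max (A2 ε * x^ε) (A3 ε * (log x)^ε)` for every `ε > 0`, `n ≥ 1`. -/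
def InMβ (f : ℕ → ℝ) (x β A1 : ℝ) (A2 A3 : ℝ → ℝ) : Prop :=
  (∀ p : ℕ, p.Prime → ∀ l : ℕ, 1 ≤ l →
      f (p ^ l) ≤ A1 ^ l * Real.log (Real.log x) ^ (β * (l : ℝ))) ∧
  (∀ ε : ℝ, 0 < ε → ∀ n : ℕ, 1 ≤ n →
      f n ≤ max (A2 ε * x ^ ε) (A3 ε * Real.log x ^ ε))

/-- `n` is `J`-smooth: every prime factor of `n` is at most `J`. -/
def JSmooth (J : ℝ) (n : ℕ) : Prop := ∀ p ∈ n.primeFactors, (p : ℝ) ≤ J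

/-- `n` is `J`-rough: every prime factor of `n` exceeds `J`. -/
def JRough (J : ℝ) (n : ℕ) : Prop := ∀ p ∈ n.primeFactors, J < (p : ℝ)

instance (J : ℝ) : DecidablePred (JSmooth J) := fun n =>
  inferInstanceAs (Decidable (∀ p ∈ n.primeFactors, (p : ℝ) ≤ J))

instance (J : ℝ) : DecidablePred (JRough J) := fun n =>
  inferInstanceAs (Decidable (∀ p ∈ n.primeFactors, J < (p : ℝ)))

/-- The roughness/smoothness cutoff `J = (log log x)^(1-β)`. -/
def Jval (x β : ℝ) : ℝ := Real.log (Real.log x) ^ (1 - β)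

lemma truncated_alternating_nonneg (n m : ℕ) (hm : Even m) :
    (if n = 0 then (1 : ℝ) else 0) ≤ ∑ j ∈ range (m + 1), (-1 : ℝ) ^ j * (n.choose j : ℝ) := by
  rcases n with _ | n
  · rw [sum_eq_single_of_mem 0 (by simp)]
    · simp
    · intro b _ hb
      rw [Nat.choose_eq_zero_of_lt (Nat.pos_of_ne_zero hb)]
      simp
  · have h := @Int.alternating_sum_range_choose_eq_choose n m
    have h' : ∑ j ∈ range (m + 1), (-1 : ℝ) ^ j * ((n + 1).choose j : ℝ) =
        (-1) ^ m * (n.choose m : ℝ) := by exact_mod_cast h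
    rw [h', hm.neg_one_pow]
    simp

lemma brun_indicator_le (P : Finset ℕ) (m : ℕ) (hm : Even m) (R : ℕ → Prop) [DecidablePred R] :
    (if ∀ p ∈ P, ¬ R p then (1 : ℝ) else 0) ≤
      ∑ S ∈ P.powerset with S.card ≤ m,
        (-1 : ℝ) ^ S.card * (if ∀ p ∈ S, R p then 1 else 0) := by
  have h := truncated_alternating_nonneg (P.filter R).card m hm
  have e1 : (if ∀ p ∈ P, ¬ R p then (1 : ℝ) else 0) =
      if (P.filter R).card = 0 then (1 : ℝ) else 0 := by
    simp [Finset.filter_eq_empty_iff]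
  have e2 : ∑ S ∈ P.powerset with S.card ≤ m,
        (-1 : ℝ) ^ S.card * (if ∀ p ∈ S, R p then (1 : ℝ) else 0) =
      ∑ S ∈ (P.filter R).powerset with S.card ≤ m, (-1 : ℝ) ^ S.card := by
    simp only [mul_ite, mul_one, mul_zero]
    rw [← sum_filter]
    apply sum_congr _ (fun _ _ => rfl)
    ext S
    simp only [mem_filter, mem_powerset, subset_iff]
    constructor
    · rintro ⟨⟨h1, h2⟩, h3⟩
      exact ⟨fun p hp => ⟨h1 hp, h3 p hp⟩, h2⟩
    · rintro ⟨h1, h2⟩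
      exact ⟨⟨fun p hp => (h1 hp).1, h2⟩, fun p hp => (h1 hp).2⟩
  rw [e1, e2]
  refine h.trans (le_of_eq ?_)
  rw [← sum_fiberwise_of_maps_to (s := ((P.filter R).powerset.filter (fun S => S.card ≤ m)))
    (t := range (m + 1)) (g := fun S => S.card) (by intro S hS; simp at hS ⊢; omega)]
  apply sum_congr rfl
  intro j hj
  rw [sum_congr rfl (g := fun _ => (-1 : ℝ) ^ j) (by
    intro S hS
    rw [(mem_filter.1 hS).2])]
  rw [sum_const, nsmul_eq_mul, mul_comm]
  congr 1
  rw [← card_powersetCard]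
  congr 2
  ext S
  simp only [mem_filter, mem_powersetCard, mem_powerset, mem_range] at *
  constructor
  · rintro ⟨h1, h2⟩; exact ⟨⟨h1, by omega⟩, h2⟩
  · rintro ⟨⟨h1, _⟩, h2⟩; exact ⟨h1, h2⟩

lemma card_small_subsets_le (P : Finset ℕ) (m : ℕ) :
    ((P.powerset.filter (fun S => S.card ≤ m)).card : ℝ) ≤ ((P.card : ℝ) + 1) ^ m := by
  have h1 : (P.powerset.filter (fun S => S.card ≤ m)).card ≤
      ∑ j ∈ range (m + 1), P.card ^ j := by
    rw [card_eq_sum_card_fiberwise (f := fun S => S.card) (t := range (m + 1))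
      (by intro S hS; simp at hS ⊢; omega)]
    apply sum_le_sum
    intro j _
    refine le_trans ?_ (Nat.choose_le_pow P.card j)
    rw [← card_powersetCard]
    apply card_le_card
    intro S hS
    simp only [mem_filter, mem_powersetCard, mem_powerset] at *
    exact ⟨hS.1.1, hS.2⟩
  have h2 : ∑ j ∈ range (m + 1), P.card ^ j ≤ (P.card + 1) ^ m := by
    rw [add_pow]
    apply sum_le_sum
    intro j hj
    simp only [one_pow, mul_one]
    have : 0 < m.choose j := Nat.choose_pos (by simp at hj; omega)
    exact Nat.le_mul_of_pos_right _ (by exact_mod_cast this)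
  exact_mod_cast h1.trans h2

/-- The multiples of `D` in `[X, X + Y]` lying in the residue class of `a` modulo `k`. -/
def apMultiples (X Y : ℝ) (k a D : ℕ) : Finset ℕ :=
  (Icc 1 ⌊X + Y⌋₊).filter fun t => X ≤ (t : ℝ) ∧ (t : ℝ) ≤ X + Y ∧ t % k = a % k ∧ D ∣ t

lemma abs_card_apMultiples_sub_le {X Y : ℝ} (hX : 1 ≤ X) (hY : 0 ≤ Y) {k a D : ℕ} (hk : 1 ≤ k)
    (hD : 1 ≤ D) (hkD : Nat.Coprime k D) :
    |((apMultiples X Y k a D).card : ℝ) - Y / (k * D)| ≤ 2 := by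
  obtain ⟨v, hv1, hv2⟩ := Nat.chineseRemainder hkD a 0
  have hr : 0 < k * D := by positivity
  have e : apMultiples X Y k a D =
      (Ioc (⌈X⌉₊ - 1) ⌊X + Y⌋₊).filter (fun t => t ≡ v [MOD (k * D)]) := by
    ext t
    simp only [apMultiples, mem_filter, mem_Icc, mem_Ioc]
    have hc : 1 ≤ ⌈X⌉₊ := Nat.one_le_ceil_iff.2 (by linarith)
    constructor
    · rintro ⟨⟨h1, h2⟩, h3, h4, h5, h6⟩
      have : ⌈X⌉₊ ≤ t := Nat.ceil_le.2 h3
      refine ⟨⟨by omega, h2⟩, ?_⟩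
      refine (Nat.modEq_and_modEq_iff_modEq_mul hkD).1 ⟨?_, ?_⟩
      · exact Nat.ModEq.trans h5 hv1.symm
      · exact Nat.ModEq.trans ((Nat.modEq_zero_iff_dvd).2 h6) hv2.symm
    · rintro ⟨⟨h1, h2⟩, h3⟩
      have h4 := (Nat.modEq_and_modEq_iff_modEq_mul hkD).2 h3
      refine ⟨⟨by omega, h2⟩, Nat.ceil_le.1 (by omega), ?_, h4.1.trans hv1,
        (Nat.modEq_zero_iff_dvd).1 (h4.2.trans hv2)⟩
      exact (Nat.cast_le.2 h2).trans (Nat.floor_le (by linarith))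
  rw [e]
  have hcard := Nat.Ioc_filter_modEq_card (⌈X⌉₊ - 1) ⌊X + Y⌋₊ hr v
  have hc : 1 ≤ ⌈X⌉₊ := Nat.one_le_ceil_iff.2 (by linarith)
  set c := ((Ioc (⌈X⌉₊ - 1) ⌊X + Y⌋₊).filter (fun t => t ≡ v [MOD (k * D)])).card with hcdef
  rw [Nat.cast_sub hc] at hcard
  set r : ℕ := k * D with hrdef
  have hr1 : (1 : ℝ) ≤ r := by exact_mod_cast hr
  have hU1 : ((⌊X + Y⌋₊ : ℕ) : ℝ) ≤ X + Y := Nat.floor_le (by linarith)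
  have hU2 : X + Y < ((⌊X + Y⌋₊ : ℕ) : ℝ) + 1 := Nat.lt_floor_add_one _
  have hV1 : X ≤ ((⌈X⌉₊ : ℕ) : ℝ) := Nat.le_ceil _
  have hV2 : ((⌈X⌉₊ : ℕ) : ℝ) < X + 1 := Nat.ceil_lt_add_one (by linarith)
  set U := ⌊X + Y⌋₊
  set V := ⌈X⌉₊
  have f1 := Int.floor_le (((U : ℚ) - v) / r)
  have f2 := Int.lt_floor_add_one (((U : ℚ) - v) / r)
  have f3 := Int.floor_le (((V : ℚ) - (1 : ℕ) - v) / r)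
  have f4 := Int.lt_floor_add_one (((V : ℚ) - (1 : ℕ) - v) / r)
  set F := ⌊((U : ℚ) - v) / r⌋
  set G := ⌊((V : ℚ) - (1 : ℕ) - v) / r⌋
  have f1' : (F : ℝ) ≤ ((U : ℝ) - v) / r := by exact_mod_cast f1
  have f2' : ((U : ℝ) - v) / r < F + 1 := by exact_mod_cast f2
  have f3' : (G : ℝ) ≤ ((V : ℝ) - (1 : ℕ) - v) / r := by exact_mod_cast f3
  have f4' : ((V : ℝ) - (1 : ℕ) - v) / r < G + 1 := by exact_mod_cast f4
  have hc' : (c : ℝ) = max ((F : ℝ) - G) 0 := by exact_mod_cast hcard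
  have key : ((U : ℝ) - v) / r - ((V : ℝ) - (1 : ℕ) - v) / r = (U - V + 1) / r := by
    push_cast; ring
  have k1 : ((U : ℝ) - V + 1) / r ≤ Y / r + 1 := by
    rw [div_add_one (by positivity)]
    gcongr; linarith
  have k2 : Y / r - 1 ≤ ((U : ℝ) - V + 1) / r := by
    rw [div_sub_one (by positivity)]
    gcongr; linarith
  have hYr : 0 ≤ Y / r := by positivity
  have er : (k : ℝ) * D = r := by rw [hrdef]; push_cast; ring
  rw [hc', er, abs_le]
  constructor
  · have := le_max_left ((F : ℝ) - G) 0
    linarith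
  · rcases max_cases ((F : ℝ) - G) 0 with ⟨h, _⟩ | ⟨h, _⟩ <;> rw [h] <;> linarith

lemma brun_sieve {X Y : ℝ} (hX : 1 ≤ X) (hY : 0 ≤ Y) {k a b : ℕ} (hk : 1 ≤ k)
    (hb : 1 ≤ b) (hkb : Nat.Coprime k b) (P : Finset ℕ) (hP : ∀ p ∈ P, p.Prime)
    (hkP : ∀ p ∈ P, Nat.Coprime k p) (m : ℕ) (hm : Even m) :
    (((apMultiples X Y k a b).filter (fun t => ∀ p ∈ P, ¬ b * p ∣ t)).card : ℝ) ≤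
      Y / (k * b) * (∏ p ∈ P, (1 - (p : ℝ)⁻¹) + Real.exp (3 * ∑ p ∈ P, (p : ℝ)⁻¹ - m)) +
        2 * ((P.card : ℝ) + 1) ^ m := by
  have hbpos : (0 : ℝ) < b := by exact_mod_cast hb
  have hkpos : (0 : ℝ) < k := by exact_mod_cast hk
  have h1 : (((apMultiples X Y k a b).filter (fun t => ∀ p ∈ P, ¬ b * p ∣ t)).card : ℝ) ≤
      ∑ S ∈ P.powerset with S.card ≤ m, (-1 : ℝ) ^ S.card *
        ((apMultiples X Y k a (b * ∏ p ∈ S, p)).card : ℝ) := by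
    rw [card_filter]
    push_cast
    calc _ ≤ ∑ t ∈ apMultiples X Y k a b, ∑ S ∈ P.powerset with S.card ≤ m,
        (-1 : ℝ) ^ S.card * (if ∀ p ∈ S, b * p ∣ t then 1 else 0) :=
          sum_le_sum fun t _ => brun_indicator_le P m hm (fun p => b * p ∣ t)
      _ = _ := by
        rw [sum_comm]
        apply sum_congr rfl
        intro S hS
        rw [← mul_sum]
        congr 1
        rw [← sum_filter, sum_const, nsmul_eq_mul, mul_one]
        congr 2
        ext t
        simp only [apMultiples, mem_filter, mem_Icc]
        have hSP : S ⊆ P := mem_powerset.1 (mem_filter.1 hS).1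
        have key : (b ∣ t ∧ ∀ p ∈ S, b * p ∣ t) ↔ b * ∏ p ∈ S, p ∣ t := by
          constructor
          · rintro ⟨⟨s, rfl⟩, h⟩
            apply Nat.mul_dvd_mul_left
            apply Finset.prod_primes_dvd
            · intro p hp; exact (hP p (hSP hp)).prime
            · intro p hp; exact Nat.dvd_of_mul_dvd_mul_left hb (h p hp)
          · intro h
            exact ⟨(Nat.dvd_mul_right _ _).trans h, fun p hp =>
              (Nat.mul_dvd_mul_left b (dvd_prod_of_mem _ hp)).trans h⟩
        rw [← key]
        tauto
  have h2 : ∀ S ∈ P.powerset.filter (fun S => S.card ≤ m), (-1 : ℝ) ^ S.card *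
        ((apMultiples X Y k a (b * ∏ p ∈ S, p)).card : ℝ) ≤
        Y / (k * b) * ((-1 : ℝ) ^ S.card * ∏ p ∈ S, (p : ℝ)⁻¹) + 2 := by
    intro S hS
    have hSP : S ⊆ P := mem_powerset.1 (mem_filter.1 hS).1
    have hpos : 1 ≤ b * ∏ p ∈ S, p := Nat.mul_pos hb
      (prod_pos fun p hp => (hP p (hSP hp)).pos)
    have hcop : Nat.Coprime k (b * ∏ p ∈ S, p) :=
      Nat.Coprime.mul_right hkb (Nat.Coprime.prod_right fun p hp => hkP p (hSP hp))
    have := abs_card_apMultiples_sub_le (a := a) hX hY hk hpos hcop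
    have e : Y / (k * ((b * ∏ p ∈ S, p : ℕ) : ℝ)) = Y / (k * b) * ∏ p ∈ S, (p : ℝ)⁻¹ := by
      push_cast
      rw [prod_inv_distrib]
      rw [div_mul_eq_div_div, div_mul_eq_div_div, div_mul_eq_div_div, div_eq_mul_inv (Y / k / b)]
    rw [e] at this
    set c := ((apMultiples X Y k a (b * ∏ p ∈ S, p)).card : ℝ)
    set d := Y / (k * b) * ∏ p ∈ S, (p : ℝ)⁻¹
    have e3 : Y / (k * b) * ((-1 : ℝ) ^ S.card * ∏ p ∈ S, (p : ℝ)⁻¹) = (-1) ^ S.card * d := by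
      simp only [d]; ring
    rw [e3]
    have h4 := abs_le.1 this
    rcases neg_one_pow_eq_or ℝ S.card with h | h <;> rw [h] <;> linarith
  refine h1.trans ((sum_le_sum h2).trans ?_)
  rw [sum_add_distrib, ← mul_sum, sum_const, nsmul_eq_mul]
  have h3 := card_small_subsets_le P m
  have h4 : ∑ S ∈ P.powerset with S.card ≤ m, ((-1 : ℝ) ^ S.card * ∏ p ∈ S, (p : ℝ)⁻¹) ≤
      ∏ p ∈ P, (1 - (p : ℝ)⁻¹) + Real.exp (3 * ∑ p ∈ P, (p : ℝ)⁻¹ - m) := by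
    have e1 : ∏ p ∈ P, (1 - (p : ℝ)⁻¹) =
        ∑ S ∈ P.powerset, ((-1 : ℝ) ^ S.card * ∏ p ∈ S, (p : ℝ)⁻¹) := by
      simp_rw [sub_eq_neg_add]
      rw [prod_add_one]
      apply sum_congr rfl
      intro S _
      rw [prod_neg]
    rw [e1, ← sum_filter_add_sum_filter_not P.powerset (fun S => S.card ≤ m)]
    have h5 : -Real.exp (3 * ∑ p ∈ P, (p : ℝ)⁻¹ - m) ≤
        ∑ S ∈ P.powerset with ¬ S.card ≤ m, ((-1 : ℝ) ^ S.card * ∏ p ∈ S, (p : ℝ)⁻¹) := by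
      have h6 : ∑ S ∈ P.powerset with ¬ S.card ≤ m, ∏ p ∈ S, (p : ℝ)⁻¹ ≤
          Real.exp (3 * ∑ p ∈ P, (p : ℝ)⁻¹ - m) := by
        calc _ ≤ ∑ S ∈ P.powerset with ¬ S.card ≤ m,
              Real.exp (-m) * ∏ p ∈ S, (Real.exp 1 * (p : ℝ)⁻¹) := by
              apply sum_le_sum
              intro S hS
              rw [prod_mul_distrib, prod_const, ← Real.exp_nat_mul, ← mul_assoc, ← Real.exp_add]
              have hp : 0 ≤ ∏ p ∈ S, (p : ℝ)⁻¹ := prod_nonneg fun p _ => by positivity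
              refine le_mul_of_one_le_left hp (Real.one_le_exp ?_)
              have : m < S.card := by simpa using (mem_filter.1 hS).2
              have : (m : ℝ) < S.card := by exact_mod_cast this
              linarith
          _ ≤ ∑ S ∈ P.powerset, Real.exp (-m) * ∏ p ∈ S, (Real.exp 1 * (p : ℝ)⁻¹) := by
              apply sum_le_sum_of_subset_of_nonneg (filter_subset _ _)
              intros
              positivity
          _ = Real.exp (-m) * ∏ p ∈ P, (Real.exp 1 * (p : ℝ)⁻¹ + 1) := by
              rw [← mul_sum, prod_add_one]
          _ ≤ Real.exp (-m) * ∏ p ∈ P, Real.exp (3 * (p : ℝ)⁻¹) := by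
              gcongr with p hp
              have h7 : Real.exp 1 ≤ 3 := by linarith [Real.exp_one_lt_d9]
              have h8 : Real.exp 1 * (p : ℝ)⁻¹ ≤ 3 * (p : ℝ)⁻¹ := by gcongr
              linarith [Real.add_one_le_exp (3 * (p : ℝ)⁻¹)]
          _ = _ := by
              rw [← Real.exp_sum, ← mul_sum, ← Real.exp_add]
              congr 1; ring
      have h9 : -∑ S ∈ P.powerset with ¬ S.card ≤ m, ∏ p ∈ S, (p : ℝ)⁻¹ ≤
          ∑ S ∈ P.powerset with ¬ S.card ≤ m, ((-1 : ℝ) ^ S.card * ∏ p ∈ S, (p : ℝ)⁻¹) := by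
        rw [← sum_neg_distrib]
        apply sum_le_sum
        intro S _
        have hp : 0 ≤ ∏ p ∈ S, (p : ℝ)⁻¹ := prod_nonneg fun p _ => by positivity
        rcases neg_one_pow_eq_or ℝ S.card with h | h <;> rw [h] <;> linarith
      linarith
    linarith
  have h5 : 0 ≤ Y / (k * b) := by positivity
  have := mul_le_mul_of_nonneg_left h4 h5
  linarith

lemma sum_multiplicative_le_prod {h : ℕ → ℝ} (h0 : ∀ n, 0 ≤ h n) (h1 : h 1 = 1)
    (hmul : ∀ m n : ℕ, Nat.Coprime m n → h (m * n) = h m * h n)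
    {P : Finset ℕ} (hP : ∀ p ∈ P, p.Prime) {G : ℕ → ℝ}
    (hs : ∀ p ∈ P, Summable fun l : ℕ => h (p ^ l)) (hG : ∀ p ∈ P, ∑' l : ℕ, h (p ^ l) ≤ G p)
    (B : Finset ℕ) (hB : ∀ b ∈ B, b ≠ 0 ∧ b.primeFactors ⊆ P) :
    ∑ b ∈ B, h b ≤ ∏ p ∈ P, G p := by
  set g : ℕ → ℝ := fun n => if n.primeFactors ⊆ P then h n else 0 with hg
  have g1 : g 1 = 1 := by simp [hg, h1]
  have gmul : ∀ {m n : ℕ}, Nat.Coprime m n → g (m * n) = g m * g n := by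
    intro m n hmn
    simp only [hg, hmn.primeFactors_mul, union_subset_iff, hmul m n hmn]
    by_cases hm : m.primeFactors ⊆ P <;> by_cases hn : n.primeFactors ⊆ P <;> simp [hm, hn]
  have gP : ∀ p ∈ P, ∀ l : ℕ, g (p ^ l) = h (p ^ l) := by
    intro p hp l
    simp only [hg]
    rw [if_pos]
    rcases Nat.eq_zero_or_pos l with rfl | hl
    · simp
    · rw [Nat.primeFactors_prime_pow hl.ne' (hP p hp)]
      simpa using hp
  have gs : ∀ {p : ℕ}, p.Prime → Summable (fun n : ℕ ↦ ‖g (p ^ n)‖) := by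
    intro p hp
    by_cases hpP : p ∈ P
    · simp only [gP p hpP, Real.norm_of_nonneg (h0 _)]
      exact hs p hpP
    · apply summable_of_ne_finset_zero (s := {0})
      intro n hn
      have hn0 : n ≠ 0 := by simpa using hn
      simp only [hg]
      rw [if_neg, norm_zero]
      rw [Nat.primeFactors_prime_pow hn0 hp]
      simpa using hpP
  have key := (EulerProduct.summable_and_hasSum_factoredNumbers_prod_filter_prime_tsum
    g1 gmul gs P).2
  rw [filter_true_of_mem hP] at key
  have e : ∏ p ∈ P, ∑' n : ℕ, g (p ^ n) ≤ ∏ p ∈ P, G p := by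
    apply prod_le_prod
    · intro p hp
      exact tsum_nonneg fun n => by rw [gP p hp]; exact h0 _
    · intro p hp
      simp only [gP p hp]
      exact hG p hp
  refine le_trans ?_ e
  have hB' : ∀ b ∈ B, b ∈ Nat.factoredNumbers P := fun b hb =>
    Nat.mem_factoredNumbers_iff_primeFactors_subset.2 (hB b hb)
  calc ∑ b ∈ B, h b = ∑ b ∈ B, g b := by
        apply sum_congr rfl
        intro b hb
        simp only [hg]
        rw [if_pos (hB b hb).2]
    _ = ∑ b ∈ B.attach, g b := (sum_attach B g).symm
    _ = ∑ m ∈ B.attach.map ⟨fun b => (⟨b.1, hB' b.1 b.2⟩ : Nat.factoredNumbers P),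
          fun b c hbc => Subtype.ext (Subtype.mk.inj hbc)⟩, g m := by
        rw [sum_map]
        rfl
    _ ≤ _ := sum_le_hasSum _ (fun m _ => by
        simp only [hg]; split_ifs; exacts [h0 _, le_rfl]) key

lemma sum_multiplicative_rpow_le_exp {f : ℕ → ℝ} (h0 : ∀ n, 0 ≤ f n) (h1 : f 1 = 1)
    (hmul : ∀ m n : ℕ, Nat.Coprime m n → f (m * n) = f m * f n)
    {P : Finset ℕ} (hP : ∀ p ∈ P, p.Prime) {M s : ℝ} (hM : 0 ≤ M)
    (hf : ∀ p ∈ P, ∀ l : ℕ, 1 ≤ l → f (p ^ l) ≤ M ^ l)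
    (hs : ∀ p ∈ P, M * (p : ℝ) ^ s ≤ 1 / 2)
    (B : Finset ℕ) (hB : ∀ b ∈ B, b ≠ 0 ∧ b.primeFactors ⊆ P) :
    ∑ b ∈ B, f b * (b : ℝ) ^ s ≤
      Real.exp (∑ p ∈ P, (f p * (p : ℝ) ^ s + 2 * (M * (p : ℝ) ^ s) ^ 2)) := by
  rw [Real.exp_sum]
  have hb : ∀ p ∈ P, ∀ l : ℕ, f (p ^ (l + 2)) * ((p ^ (l + 2) : ℕ) : ℝ) ^ s ≤
      (M * (p : ℝ) ^ s) ^ 2 * (M * (p : ℝ) ^ s) ^ l := by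
    intro p hp l
    have e : ((p ^ (l + 2) : ℕ) : ℝ) ^ s = ((p : ℝ) ^ s) ^ (l + 2) := by
      push_cast
      rw [← Real.rpow_natCast, ← Real.rpow_mul (by positivity), mul_comm,
        Real.rpow_mul (by positivity), Real.rpow_natCast]
    rw [e, ← pow_add, mul_pow, add_comm 2 l]
    exact mul_le_mul_of_nonneg_right (hf p hp _ (by omega)) (by positivity)
  have hn : ∀ n : ℕ, 0 ≤ f n * (n : ℝ) ^ s := fun n => mul_nonneg (h0 n) (by positivity)
  have hgeo : ∀ p ∈ P, Summable fun l : ℕ => (M * (p : ℝ) ^ s) ^ 2 * (M * (p : ℝ) ^ s) ^ l := by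
    intro p hp
    apply Summable.mul_left
    apply summable_geometric_of_lt_one (by positivity)
    linarith [hs p hp]
  have hsum2 : ∀ p ∈ P, Summable fun l : ℕ => f (p ^ (l + 2)) * ((p ^ (l + 2) : ℕ) : ℝ) ^ s :=
    fun p hp => Summable.of_nonneg_of_le (fun l => hn _) (hb p hp) (hgeo p hp)
  have hsum : ∀ p ∈ P, Summable fun l : ℕ => f (p ^ l) * ((p ^ l : ℕ) : ℝ) ^ s :=
    fun p hp => (summable_nat_add_iff 2).1 (hsum2 p hp)
  apply sum_multiplicative_le_prod (h := fun n => f n * (n : ℝ) ^ s) hn (by simp [h1])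
    _ hP hsum _ B hB
  · intro m n hmn
    rw [hmul m n hmn]
    push_cast
    rw [Real.mul_rpow (by positivity) (by positivity)]
    ring
  · intro p hp
    rw [← (hsum p hp).sum_add_tsum_nat_add 2]
    have h3 : ∑' l : ℕ, f (p ^ (l + 2)) * ((p ^ (l + 2) : ℕ) : ℝ) ^ s ≤
        2 * (M * (p : ℝ) ^ s) ^ 2 := by
      refine ((hsum2 p hp).tsum_le_tsum (hb p hp) (hgeo p hp)).trans ?_
      have hu0 : 0 ≤ M * (p : ℝ) ^ s := by positivity
      have hu := hs p hp
      rw [tsum_mul_left, tsum_geometric_of_lt_one hu0 (by linarith)]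
      rw [mul_comm]
      apply mul_le_mul_of_nonneg_right _ (by positivity)
      rw [inv_le_comm₀ (by linarith) (by norm_num)]
      linarith
    have h4 : ∑ i ∈ range 2, f (p ^ i) * ((p ^ i : ℕ) : ℝ) ^ s = 1 + f p * (p : ℝ) ^ s := by
      simp [sum_range_succ, h1]
    rw [h4]
    have := Real.add_one_le_exp (f p * (p : ℝ) ^ s + 2 * (M * (p : ℝ) ^ s) ^ 2)
    linarith

lemma prod_one_sub_inv_primes_le (N : ℕ) (hN : 1 ≤ N) :
    ∏ p ∈ Icc 1 N with p.Prime, (1 - (p : ℝ)⁻¹) ≤ (Real.log (N + 1))⁻¹ := by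
  have hlog : 0 < Real.log (N + 1) := Real.log_pos (by
    have : (1 : ℝ) ≤ N := by exact_mod_cast hN
    linarith)
  have hlt : ∀ p ∈ (Icc 1 N).filter Nat.Prime, (p : ℝ)⁻¹ < 1 := by
    intro p hp
    have : (1 : ℝ) < p := by exact_mod_cast (mem_filter.1 hp).2.one_lt
    exact inv_lt_one_of_one_lt₀ this
  have h := sum_multiplicative_le_prod (h := fun n => (n : ℝ)⁻¹)
    (P := (Icc 1 N).filter Nat.Prime) (G := fun p => (1 - (p : ℝ)⁻¹)⁻¹) (fun n => by positivity)
    (by simp) (by intro m n _; push_cast; rw [mul_inv]) (by simp)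
    (by
      intro p hp
      simp only [Nat.cast_pow, ← inv_pow]
      exact summable_geometric_of_lt_one (by positivity) (hlt p hp))
    (by
      intro p hp
      simp only [Nat.cast_pow, ← inv_pow]
      rw [tsum_geometric_of_lt_one (by positivity) (hlt p hp)]) (Icc 1 N)
    (by
      intro b hb
      rw [mem_Icc] at hb
      refine ⟨by omega, fun p hp => ?_⟩
      have := Nat.prime_of_mem_primeFactors hp
      simp only [mem_filter, mem_Icc]
      exact ⟨⟨this.one_le, (Nat.le_of_mem_primeFactors hp).trans hb.2⟩, this⟩)
  have h2 := log_add_one_le_harmonic N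
  rw [harmonic_eq_sum_Icc] at h2
  push_cast at h2
  rw [prod_inv_distrib] at h
  rw [le_inv_comm₀ _ hlog]
  · exact h2.trans h
  · exact prod_pos fun p hp => by linarith [hlt p hp]

lemma prod_one_sub_inv_coprime_le (N k : ℕ) (hN : 1 ≤ N) (hk : 1 ≤ k) :
    ∏ p ∈ Icc 1 N with p.Prime ∧ ¬ p ∣ k, (1 - (p : ℝ)⁻¹) ≤
      (k / Nat.totient k : ℝ) * (Real.log (N + 1))⁻¹ := by
  have hk' : (0 : ℝ) < k := by exact_mod_cast hk
  have hphi : (0 : ℝ) < Nat.totient k := by exact_mod_cast Nat.totient_pos.2 hk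
  have h := prod_one_sub_inv_primes_le N hN
  have hpr : ∀ p : ℕ, p.Prime → 0 < 1 - (p : ℝ)⁻¹ := by
    intro p hp
    have : (1 : ℝ) < p := by exact_mod_cast hp.one_lt
    linarith [inv_lt_one_of_one_lt₀ this]
  rw [← prod_filter_mul_prod_filter_not ((Icc 1 N).filter Nat.Prime) (fun p => ¬ p ∣ k),
    filter_filter, filter_filter] at h
  have h1 : (Nat.totient k : ℝ) / k ≤ ∏ p ∈ Icc 1 N with p.Prime ∧ ¬ ¬ p ∣ k, (1 - (p : ℝ)⁻¹) := by
    have e : (Nat.totient k : ℝ) = k * ∏ p ∈ k.primeFactors, (1 - (p : ℝ)⁻¹) := by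
      have := Nat.totient_eq_mul_prod_factors k
      have h2 : ((Nat.totient k : ℚ) : ℝ) = ((k * ∏ p ∈ k.primeFactors, (1 - (p : ℚ)⁻¹) : ℚ) : ℝ) :=
        by rw [this]
      push_cast at h2
      exact h2
    rw [e, mul_div_cancel_left₀ _ hk'.ne']
    have hsub : (Icc 1 N).filter (fun p => p.Prime ∧ ¬ ¬ p ∣ k) ⊆ k.primeFactors := by
      intro p hp
      simp only [mem_filter, not_not] at hp
      exact Nat.mem_primeFactors.2 ⟨hp.2.1, hp.2.2, by omega⟩
    rw [← prod_sdiff hsub]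
    apply mul_le_of_le_one_left
    · exact prod_nonneg fun p hp => (hpr p (mem_filter.1 hp).2.1).le
    · apply prod_le_one
      · intro p hp
        exact (hpr p (Nat.prime_of_mem_primeFactors (mem_sdiff.1 hp).1)).le
      · intro p _
        have : (0 : ℝ) ≤ (p : ℝ)⁻¹ := by positivity
        linarith
  set A := ∏ p ∈ Icc 1 N with p.Prime ∧ ¬ p ∣ k, (1 - (p : ℝ)⁻¹) with hA
  have hA0 : 0 ≤ A := prod_nonneg fun p hp => (hpr p (mem_filter.1 hp).2.1).le
  have h3 : A * ((Nat.totient k : ℝ) / k) ≤ (Real.log (N + 1))⁻¹ :=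
    (mul_le_mul_of_nonneg_left h1 hA0).trans h
  calc A = (k / Nat.totient k : ℝ) * (A * ((Nat.totient k : ℝ) / k)) := by field_simp
    _ ≤ _ := by gcongr

lemma sum_log_div_primes_le (N : ℕ) :
    ∑ p ∈ Icc 1 N with p.Prime, Real.log p / p ≤ 2 * Real.log N := by
  rcases Nat.eq_zero_or_pos N with rfl | hN
  · simp
  have hNpos : (0 : ℝ) < N := by exact_mod_cast hN
  have h1 : ∑ n ∈ Ioc 0 N, ∑ p ∈ Icc 1 N with p.Prime,
      (if p ∣ n then Real.log p else 0) ≤ N * Real.log N := by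
    calc _ ≤ ∑ n ∈ Ioc 0 N, Real.log N := by
          apply sum_le_sum
          intro n hn
          rw [mem_Ioc] at hn
          rw [← sum_filter, ← Real.log_prod]
          · apply Real.log_le_log
            · apply prod_pos
              intro p hp
              exact_mod_cast (mem_filter.1 (mem_filter.1 hp).1).2.pos
            · have h2 : ∏ p ∈ ((Icc 1 N).filter Nat.Prime).filter (fun p => p ∣ n), p ∣ n := by
                apply Finset.prod_primes_dvd
                · intro p hp
                  exact (mem_filter.1 (mem_filter.1 hp).1).2.prime
                · intro p hp
                  exact (mem_filter.1 hp).2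
              have h3 := (Nat.le_of_dvd hn.1 h2).trans hn.2
              rw [← Nat.cast_prod]
              exact Nat.cast_le.2 h3
          · intro p hp
            exact_mod_cast (mem_filter.1 (mem_filter.1 hp).1).2.ne_zero
      _ = N * Real.log N := by simp
  rw [sum_comm] at h1
  have h2 : ∀ p ∈ (Icc 1 N).filter Nat.Prime, (N : ℝ) / 2 * (Real.log p / p) ≤
      ∑ n ∈ Ioc 0 N, (if p ∣ n then Real.log p else 0) := by
    intro p hp
    rw [mem_filter, mem_Icc] at hp
    rw [← sum_filter, sum_const, Nat.Ioc_filter_dvd_card_eq_div, nsmul_eq_mul]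
    have hp0 : (0 : ℝ) < p := by exact_mod_cast hp.2.pos
    have hlog : 0 ≤ Real.log p := Real.log_natCast_nonneg p
    have h3 : (N : ℝ) / 2 / p ≤ ((N / p : ℕ) : ℝ) := by
      have h4 : N < p * (N / p) + p := by
        have := Nat.div_add_mod N p
        have := Nat.mod_lt N hp.2.pos
        omega
      have h5 : 1 ≤ N / p := (Nat.one_le_div_iff hp.2.pos).2 hp.1.2
      have h6 : N ≤ 2 * (p * (N / p)) := by nlinarith
      have h7 : (N : ℝ) ≤ 2 * (p * ((N / p : ℕ) : ℝ)) := by exact_mod_cast h6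
      rw [div_le_iff₀ hp0]
      linarith
    calc (N : ℝ) / 2 * (Real.log p / p) = (N : ℝ) / 2 / p * Real.log p := by ring
      _ ≤ _ := by gcongr
  have h3 := (sum_le_sum h2).trans h1
  rw [← mul_sum] at h3
  have h4 : (N : ℝ) / 2 * ∑ p ∈ Icc 1 N with p.Prime, Real.log p / p ≤
    (N : ℝ) / 2 * (2 * Real.log N) := by linarith
  exact le_of_mul_le_mul_left h4 (by positivity)

lemma sum_inv_primes_two_pow_le (j : ℕ) :
    ∑ p ∈ (Icc 1 (2 ^ 2 ^ j)).filter Nat.Prime, (p : ℝ)⁻¹ ≤ 1 + 4 * j := by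
  induction j with
  | zero =>
    have : ((Icc 1 (2 ^ 2 ^ 0)).filter Nat.Prime) = {2} := by decide
    rw [this]
    norm_num
  | succ j ih =>
    rw [← sum_filter_add_sum_filter_not _ (fun p => p ≤ 2 ^ 2 ^ j)]
    have e1 : ((Icc 1 (2 ^ 2 ^ (j + 1))).filter Nat.Prime).filter (fun p => p ≤ 2 ^ 2 ^ j) =
        (Icc 1 (2 ^ 2 ^ j)).filter Nat.Prime := by
      ext p
      simp only [mem_filter, mem_Icc]
      have : 2 ^ 2 ^ j ≤ 2 ^ 2 ^ (j + 1) :=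
        Nat.pow_le_pow_right (by norm_num) (Nat.pow_le_pow_right (by norm_num) (by omega))
      constructor
      · rintro ⟨⟨⟨h1, h2⟩, h3⟩, h4⟩; exact ⟨⟨h1, h4⟩, h3⟩
      · rintro ⟨⟨h1, h2⟩, h3⟩; exact ⟨⟨⟨h1, h2.trans this⟩, h3⟩, h2⟩
    rw [e1]
    have hl2 : 0 < Real.log 2 := Real.log_pos (by norm_num)
    have h2 : ∑ p ∈ (Icc 1 (2 ^ 2 ^ (j + 1))).filter Nat.Prime with ¬ p ≤ 2 ^ 2 ^ j, (p : ℝ)⁻¹ ≤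
        4 := by
      have h3 := sum_log_div_primes_le (2 ^ 2 ^ (j + 1))
      have hc : 0 < 2 ^ j * Real.log 2 := by positivity
      have h4 : (2 ^ j * Real.log 2) * ∑ p ∈ (Icc 1 (2 ^ 2 ^ (j + 1))).filter Nat.Prime with
          ¬ p ≤ 2 ^ 2 ^ j, (p : ℝ)⁻¹ ≤ ∑ p ∈ (Icc 1 (2 ^ 2 ^ (j + 1))).filter Nat.Prime,
          Real.log p / p := by
        rw [mul_sum]
        refine (sum_le_sum ?_).trans (sum_le_sum_of_subset_of_nonneg (filter_subset _ _) ?_)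
        · intro p hp
          simp only [mem_filter, mem_Icc, not_le] at hp
          rw [div_eq_mul_inv]
          apply mul_le_mul_of_nonneg_right _ (by positivity)
          have : ((2 : ℝ) ^ 2 ^ j) ≤ p := by exact_mod_cast hp.2.le
          have h5 := Real.log_le_log (by positivity) this
          rw [Real.log_pow] at h5
          exact_mod_cast h5
        · intro p _ _
          exact div_nonneg (Real.log_natCast_nonneg p) (by positivity)
      have h5 : 2 * Real.log ((2 ^ 2 ^ (j + 1) : ℕ) : ℝ) = (2 ^ j * Real.log 2) * 4 := by
        push_cast
        rw [Real.log_pow]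
        push_cast
        ring
      rw [h5] at h3
      exact le_of_mul_le_mul_left (h4.trans h3) hc
    push_cast
    linarith

lemma sum_inv_primes_le {N : ℕ} {l : ℝ} (hN : 1 ≤ N) (hl : 0 ≤ l)
    (h : Real.log N ≤ Real.exp l) :
    ∑ p ∈ Icc 1 N with p.Prime, (p : ℝ)⁻¹ ≤ 8 * l + 9 := by
  set j := ⌈2 * l + 1⌉₊
  have hj1 : 2 * l + 1 ≤ j := Nat.le_ceil _
  have hj2 : (j : ℝ) < 2 * l + 1 + 1 := Nat.ceil_lt_add_one (by linarith)
  have hl2 := Real.log_two_gt_d9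
  have hNpos : (0 : ℝ) < N := by exact_mod_cast hN
  have key : N ≤ 2 ^ 2 ^ j := by
    have : (N : ℝ) ≤ 2 ^ 2 ^ j := by
      rw [← Real.log_le_log_iff hNpos (by positivity), Real.log_pow]
      push_cast
      have h1 : Real.exp l ≤ 2 ^ j * Real.log 2 := by
        rw [← Real.log_le_log_iff (by positivity) (by positivity), Real.log_exp,
          Real.log_mul (by positivity) (by positivity), Real.log_pow]
        have h2 : -0.5 ≤ Real.log (Real.log 2) := by
          rw [Real.le_log_iff_exp_le (by positivity)]
          have h3 : Real.exp (-0.5) ^ 2 ≤ 0.6 ^ 2 + 0.05 := by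
            rw [← Real.exp_nat_mul]
            norm_num
            rw [Real.exp_neg]
            have := Real.exp_one_gt_d9
            rw [inv_le_comm₀ (by positivity) (by norm_num)]
            linarith
          nlinarith [Real.exp_pos (-0.5)]
        nlinarith
      linarith
    exact_mod_cast this
  refine le_trans (sum_le_sum_of_subset_of_nonneg ?_ ?_) ((sum_inv_primes_two_pow_le j).trans ?_)
  · intro p hp
    simp only [mem_filter, mem_Icc] at hp ⊢
    exact ⟨⟨hp.1.1, hp.1.2.trans key⟩, hp.2⟩
  · intros; positivity
  · linarith

lemma exists_prefix_split {t : ℕ} (ht : t ≠ 0) {z : ℝ} (hz : 1 ≤ z) (hzt : z < t) :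
    ∃ b q s : ℕ, q.Prime ∧ 1 ≤ s ∧ b * q ^ s ∣ t ∧ (b : ℝ) ≤ z ∧ z < (b : ℝ) * (q : ℝ) ^ s ∧
      (∀ p ∈ b.primeFactors, p < q) ∧ Nat.Coprime b (t / b) ∧
      ∀ p ∈ (t / b).primeFactors, q ≤ p := by
  classical
  set F : ℕ → ℕ := fun y => ∏ p ∈ t.primeFactors with p < y, p ^ t.factorization p with hF
  set H : ℕ → ℕ := fun y => ∏ p ∈ t.primeFactors with ¬ p < y, p ^ t.factorization p with hH
  have ht' : ∏ p ∈ t.primeFactors, p ^ t.factorization p = t :=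
    Nat.prod_factorization_pow_eq_self ht
  have hFH : ∀ y, F y * H y = t := fun y => by
    rw [← ht', hF, hH, ← prod_filter_mul_prod_filter_not t.primeFactors (fun p => p < y)]
  have hex : ∃ y, z < F y := by
    refine ⟨t + 1, ?_⟩
    have : F (t + 1) = t := by
      simp only [hF]
      rw [filter_true_of_mem, ht']
      intro p hp
      exact Nat.lt_succ_of_le (Nat.le_of_mem_primeFactors hp)
    rw [this]; exact hzt
  have hmin := fun m => Nat.find_min hex (m := m)
  have hspec := Nat.find_spec hex
  rcases hn : Nat.find hex with _ | q
  · rw [hn] at hspec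
    simp [hF] at hspec
    linarith
  · rw [hn] at hspec
    have hq : (F q : ℝ) ≤ z := not_lt.1 (hmin q (by omega))
    have hqm : q ∈ t.primeFactors := by
      by_contra hq'
      have : F (q + 1) = F q := by
        simp only [hF]
        congr 1
        ext p
        simp only [mem_filter]
        constructor
        · rintro ⟨h1, h2⟩
          refine ⟨h1, ?_⟩
          rcases Nat.lt_succ_iff_lt_or_eq.1 h2 with h | h
          · exact h
          · subst h; exact absurd h1 hq'
        · rintro ⟨h1, h2⟩; exact ⟨h1, by omega⟩
      rw [this] at hspec
      linarith
    have hqp := Nat.prime_of_mem_primeFactors hqm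
    have hstep : F (q + 1) = F q * q ^ t.factorization q := by
      have : (t.primeFactors.filter (fun p => p < q + 1)) =
          insert q (t.primeFactors.filter (fun p => p < q)) := by
        ext p
        simp only [mem_filter, mem_insert]
        constructor
        · rintro ⟨h1, h2⟩
          rcases Nat.lt_succ_iff_lt_or_eq.1 h2 with h | h
          · exact Or.inr ⟨h1, h⟩
          · exact Or.inl h
        · rintro (h | ⟨h1, h2⟩)
          · subst h; exact ⟨hqm, by omega⟩
          · exact ⟨h1, by omega⟩
      simp only [hF]
      rw [this, prod_insert (by simp), mul_comm]
    have hpos : 0 < F q := Nat.pos_of_ne_zero (left_ne_zero_of_mul (by rw [hFH]; exact ht))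
    have hdiv : t / F q = H q := by
      rw [← hFH q, Nat.mul_div_cancel_left _ hpos]
    have hprF : ∀ p ∈ (F q).primeFactors, p < q := by
      intro p hp
      have hpp := Nat.prime_of_mem_primeFactors hp
      obtain ⟨r, hr, hr2⟩ := (hpp.prime.dvd_finsetProd_iff _).1 (Nat.dvd_of_mem_primeFactors hp)
      rw [mem_filter] at hr
      have := (Nat.prime_dvd_prime_iff_eq hpp (Nat.prime_of_mem_primeFactors hr.1)).1
        (hpp.dvd_of_dvd_pow hr2)
      omega
    have hprH : ∀ p ∈ (H q).primeFactors, q ≤ p := by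
      intro p hp
      have hpp := Nat.prime_of_mem_primeFactors hp
      obtain ⟨r, hr, hr2⟩ := (hpp.prime.dvd_finsetProd_iff _).1 (Nat.dvd_of_mem_primeFactors hp)
      rw [mem_filter] at hr
      have := (Nat.prime_dvd_prime_iff_eq hpp (Nat.prime_of_mem_primeFactors hr.1)).1
        (hpp.dvd_of_dvd_pow hr2)
      omega
    refine ⟨F q, q, t.factorization q, hqp, ?_, ?_, hq, ?_, hprF, ?_, ?_⟩
    · exact (hqp.dvd_iff_one_le_factorization ht).1 (Nat.dvd_of_mem_primeFactors hqm)
    · rw [← hstep]; exact ⟨_, (hFH (q + 1)).symm⟩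
    · rw [hstep] at hspec; exact_mod_cast hspec
    · rw [hdiv]
      apply Nat.Coprime.symm
      refine Nat.Coprime.symm (Nat.coprime_of_dvd ?_)
      intro p hpp h1 h2
      have h3 := hprF p (Nat.mem_primeFactors.2 ⟨hpp, h1, hpos.ne'⟩)
      have h4 := hprH p (Nat.mem_primeFactors.2 ⟨hpp, h2,
        right_ne_zero_of_mul (a := F q) (by rw [hFH]; exact ht)⟩)
      omega
    · rw [hdiv]; exact hprH

lemma multiplicative_le_rpow {f : ℕ → ℝ} (h0 : ∀ n, 0 ≤ f n) (h1 : f 1 = 1)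
    (hmul : ∀ m n : ℕ, Nat.Coprime m n → f (m * n) = f m * f n) {M y : ℝ} (hM : 1 ≤ M)
    (hf : ∀ p : ℕ, p.Prime → ∀ l : ℕ, 1 ≤ l → f (p ^ l) ≤ M ^ l) (hy : 1 < y)
    {d : ℕ} (hd : d ≠ 0) (hdy : ∀ p ∈ d.primeFactors, y ≤ (p : ℝ)) :
    f d ≤ M ^ (Real.log d / Real.log y) := by
  rw [Nat.multiplicative_factorization f hmul h1 hd]
  have hlogy : 0 < Real.log y := Real.log_pos hy
  have h2 : (d.factorization.prod fun p k => f (p ^ k)) ≤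
      M ^ (∑ p ∈ d.primeFactors, d.factorization p) := by
    rw [← prod_pow_eq_pow_sum]
    apply prod_le_prod
    · intros; exact h0 _
    · intro p hp
      have hpp := Nat.prime_of_mem_primeFactors hp
      exact hf p hpp _ ((hpp.dvd_iff_one_le_factorization hd).1 (Nat.dvd_of_mem_primeFactors hp))
  refine h2.trans ?_
  rw [← Real.rpow_natCast]
  apply Real.rpow_le_rpow_of_exponent_le hM
  rw [le_div_iff₀ hlogy]
  have e : (d : ℝ) = ∏ p ∈ d.primeFactors, (p : ℝ) ^ d.factorization p := by
    have : d = ∏ p ∈ d.primeFactors, p ^ d.factorization p :=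
      (Nat.prod_factorization_pow_eq_self hd).symm
    conv_lhs => rw [this]
    push_cast
    rfl
  rw [e, Real.log_prod (by
    intro p hp
    have := (Nat.prime_of_mem_primeFactors hp).pos
    positivity)]
  push_cast
  rw [sum_mul]
  apply sum_le_sum
  intro p hp
  rw [Real.log_pow]
  exact mul_le_mul_of_nonneg_left (Real.log_le_log (by linarith) (hdy p hp)) (by positivity)

/-- The integers `t` in a progression divisible by `b` such that no prime
`p ≤ w` outside the divisors of `k` divides `t / b`. -/
def siftedSet (X Y w : ℝ) (k a b : ℕ) : Finset ℕ :=
  open Classical in (apMultiples X Y k a b).filter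
    (fun t => ∀ p : ℕ, p.Prime → (p : ℝ) ≤ w → ¬ p ∣ k → ¬ b * p ∣ t)

lemma mem_siftedSet_iff {X Y w : ℝ} {k a b t : ℕ} :
    t ∈ siftedSet X Y w k a b ↔ t ∈ apMultiples X Y k a b ∧
      ∀ p : ℕ, p.Prime → (p : ℝ) ≤ w → ¬ p ∣ k → ¬ b * p ∣ t := by
  classical
  simp only [siftedSet, mem_filter]

lemma card_rough_quotient_le {X Y w l : ℝ} (hX : 1 ≤ X) (hY : 0 ≤ Y) {k a b m : ℕ} (hk : 1 ≤ k)
    (hb : 1 ≤ b) (hkb : Nat.Coprime k b) (hl : 0 ≤ l) (hw : 1 < w) (hwl : Real.log w ≤ Real.exp l)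
    (hm : Even m) (hml : 25 * l + 27 ≤ m)
    (hwm : 2 * (w + 1) ^ m ≤ Y / (k * b) * Real.exp (-l)) :
    ((siftedSet X Y w k a b).card : ℝ) ≤
      Y / (Nat.totient k) * (b : ℝ)⁻¹ * (3 / Real.log w) := by
  have hk' : (0 : ℝ) < k := by exact_mod_cast hk
  have hb' : (0 : ℝ) < b := by exact_mod_cast hb
  have hphi : (0 : ℝ) < Nat.totient k := by exact_mod_cast Nat.totient_pos.2 hk
  have hphik : (Nat.totient k : ℝ) ≤ k := by exact_mod_cast Nat.totient_le k
  have hN : 1 ≤ ⌊w⌋₊ := Nat.one_le_floor_iff _ |>.2 hw.le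
  have hNw : ((⌊w⌋₊ : ℕ) : ℝ) ≤ w := Nat.floor_le (by linarith)
  have hNw' : w < ((⌊w⌋₊ : ℕ) : ℝ) + 1 := Nat.lt_floor_add_one w
  have hlw : 0 < Real.log w := Real.log_pos hw
  set P := (Icc 1 ⌊w⌋₊).filter (fun p => p.Prime ∧ ¬ p ∣ k) with hP
  have h := brun_sieve (a := a) hX hY hk hb hkb P (fun p hp => (mem_filter.1 hp).2.1)
    (fun p hp => ((Nat.Prime.coprime_iff_not_dvd (mem_filter.1 hp).2.1).2
      (mem_filter.1 hp).2.2).symm) m hm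
  have hsub : ((siftedSet X Y w k a b).card : ℝ) ≤
      (((apMultiples X Y k a b).filter (fun t => ∀ p ∈ P, ¬ b * p ∣ t)).card : ℝ) := by
    norm_cast
    apply card_le_card
    intro t ht
    rw [mem_siftedSet_iff] at ht
    rw [mem_filter]
    refine ⟨ht.1, fun p hp => ?_⟩
    simp only [hP, mem_filter, mem_Icc] at hp
    exact ht.2 p hp.2.1 ((Nat.le_floor_iff (by linarith)).1 hp.1.2) hp.2.2
  refine hsub.trans (h.trans ?_)
  have h1 : ∏ p ∈ P, (1 - (p : ℝ)⁻¹) ≤ (k / Nat.totient k : ℝ) * (Real.log w)⁻¹ := by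
    refine (prod_one_sub_inv_coprime_le ⌊w⌋₊ k hN hk).trans ?_
    gcongr
  have hone : (1 : ℝ) ≤ k / Nat.totient k := (one_le_div hphi).2 hphik
  have hel : Real.exp (-l) ≤ (Real.log w)⁻¹ := by
    rw [Real.exp_neg]
    gcongr
  have h2 : Real.exp (3 * ∑ p ∈ P, (p : ℝ)⁻¹ - m) ≤ (k / Nat.totient k : ℝ) * (Real.log w)⁻¹ := by
    have h3 : ∑ p ∈ P, (p : ℝ)⁻¹ ≤ 8 * l + 9 := by
      refine le_trans ?_ (sum_inv_primes_le hN hl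
        ((Real.log_le_log (by exact_mod_cast hN) hNw).trans hwl))
      apply sum_le_sum_of_subset_of_nonneg
      · intro p hp
        simp only [hP, mem_filter] at hp ⊢
        exact ⟨hp.1, hp.2.1⟩
      · intros; positivity
    calc Real.exp (3 * ∑ p ∈ P, (p : ℝ)⁻¹ - m) ≤ Real.exp (-l) := by
          apply Real.exp_le_exp.2; linarith
      _ ≤ 1 * (Real.log w)⁻¹ := by rw [one_mul]; exact hel
      _ ≤ _ := by gcongr
  have h3 : 2 * ((P.card : ℝ) + 1) ^ m ≤
      Y / (k * b) * ((k / Nat.totient k : ℝ) * (Real.log w)⁻¹) := by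
    have hc : (P.card : ℝ) ≤ w := by
      have : P.card ≤ ⌊w⌋₊ := (card_filter_le _ _).trans (by simp)
      exact (Nat.cast_le.2 this).trans hNw
    calc 2 * ((P.card : ℝ) + 1) ^ m ≤ 2 * (w + 1) ^ m := by gcongr
      _ ≤ Y / (k * b) * Real.exp (-l) := hwm
      _ ≤ Y / (k * b) * (1 * (Real.log w)⁻¹) := by rw [one_mul]; gcongr
      _ ≤ _ := by gcongr
  calc _ ≤ Y / (k * b) * ((k / Nat.totient k : ℝ) * (Real.log w)⁻¹ +
        (k / Nat.totient k : ℝ) * (Real.log w)⁻¹) +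
        Y / (k * b) * ((k / Nat.totient k : ℝ) * (Real.log w)⁻¹) := by gcongr
    _ = _ := by field_simp; ring

lemma sum_le_sum_mul_card_of_cover {ι : Type*} {T : Finset ℕ} {f : ℕ → ℝ} (I : Finset ι)
    (S : ι → Finset ℕ) (c : ι → ℝ) (hc : ∀ i ∈ I, 0 ≤ c i)
    (h : ∀ t ∈ T, ∃ i ∈ I, t ∈ S i ∧ f t ≤ c i) :
    ∑ t ∈ T, f t ≤ ∑ i ∈ I, c i * ((S i).card : ℝ) := by
  classical
  calc ∑ t ∈ T, f t ≤ ∑ t ∈ T, ∑ i ∈ I, (if t ∈ S i then c i else 0) := by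
        apply sum_le_sum
        intro t ht
        obtain ⟨i, hi, h1, h2⟩ := h t ht
        refine h2.trans ?_
        refine le_trans ?_ (single_le_sum (f := fun i => if t ∈ S i then c i else 0) ?_ hi)
        · simp [h1]
        · intro j hj
          split_ifs
          exacts [hc j hj, le_rfl]
    _ = ∑ i ∈ I, ∑ t ∈ T, (if t ∈ S i then c i else 0) := sum_comm
    _ ≤ _ := by
        apply sum_le_sum
        intro i hi
        rw [← sum_filter, sum_const, nsmul_eq_mul, mul_comm]
        apply mul_le_mul_of_nonneg_left _ (hc i hi)
        norm_cast
        apply card_le_card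
        intro t ht
        exact (mem_filter.1 ht).2

/-- The `J`-rough integers in `[X, X + Y]` congruent to `a` modulo `k`. -/
def roughSet (X Y J : ℝ) (k a : ℕ) : Finset ℕ :=
  (Icc 1 ⌊X + Y⌋₊).filter fun t : ℕ =>
    X ≤ (t : ℝ) ∧ (t : ℝ) ≤ X + Y ∧ t % k = a % k ∧ JRough J t

/-- The primes in `(J, y]` not dividing `k`. -/
def primesBetween (J y : ℝ) (k : ℕ) : Finset ℕ :=
  (Icc 1 ⌊y⌋₊).filter fun p : ℕ => p.Prime ∧ J < (p : ℝ) ∧ ¬ p ∣ k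

/-- The integers in `[1, exp Z]` all of whose prime factors lie in `(J, y]` and do not
divide `k`. -/
def smoothSet (Z J y : ℝ) (k : ℕ) : Finset ℕ :=
  (Icc 1 ⌊Real.exp Z⌋₊).filter fun b : ℕ => b.primeFactors ⊆ primesBetween J y k

/-- Size conditions on the parameters under which the sum of `f` over rough integers is
estimated. -/
structure RoughSetting (f : ℕ → ℝ) (x X Y J M Z D l F W : ℝ) (k m R : ℕ) : Prop where
  nonneg : ∀ n, 0 ≤ f n
  map_one : f 1 = 1
  map_mul : ∀ m n : ℕ, Nat.Coprime m n → f (m * n) = f m * f n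
  one_le_M : 1 ≤ M
  pow_le : ∀ p : ℕ, p.Prime → ∀ j : ℕ, 1 ≤ j → f (p ^ j) ≤ M ^ j
  le_F : ∀ n : ℕ, 1 ≤ n → f n ≤ F
  F_nonneg : 0 ≤ F
  one_le_X : 1 ≤ X
  Y_le_X : Y ≤ X
  X_le_x : X ≤ x
  one_le_k : 1 ≤ k
  Z_pos : 0 < Z
  exp_Z_lt : Real.exp Z < Y
  exp_two_Z_le : Real.exp (2 * Z) ≤ Y / k
  Z_le : Z ≤ Real.exp l
  log_two_x_le : Real.log (2 * x) ≤ D * Z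
  one_le_l : 1 ≤ l
  four_le_J : 4 ≤ J
  M_sq_le : 4 * M ^ 2 ≤ J
  even_m : Even m
  le_m : 25 * l + 27 ≤ m
  one_lt_W : 1 < W
  log_W_le : Real.log W ≤ Real.exp l
  W_pow_le : 2 * (W + 1) ^ m * Real.exp l ≤ Real.exp Z
  four_le_R : 4 ≤ R
  log_W_le_div : Real.log W ≤ Z / R

lemma sum_inv_sq_primesBetween_le {J : ℝ} (hJ : 1 ≤ J) (y : ℝ) (k : ℕ) :
    ∑ p ∈ primesBetween J y k, ((p : ℝ) ^ 2)⁻¹ ≤ 2 / J := by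
  have hsub : primesBetween J y k ⊆ Ioo ⌊J⌋₊ (⌊y⌋₊ + 1) := by
    intro p hp
    simp only [primesBetween, mem_filter, mem_Icc] at hp
    rw [mem_Ioo]
    exact ⟨(Nat.floor_lt (by linarith)).2 hp.2.2.1, by omega⟩
  refine (sum_le_sum_of_subset_of_nonneg hsub (by intros; positivity)).trans ?_
  refine (sum_Ioo_inv_sq_le (α := ℝ) _ _).trans ?_
  have := Nat.lt_floor_add_one J
  gcongr

lemma mem_smoothSet_iff {Z J y : ℝ} {k b : ℕ} :
    b ∈ smoothSet Z J y k ↔ 1 ≤ b ∧ (b : ℝ) ≤ Real.exp Z ∧ ∀ p ∈ b.primeFactors,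
      (p : ℝ) ≤ y ∧ J < (p : ℝ) ∧ ¬ p ∣ k := by
  simp only [smoothSet, primesBetween, mem_filter, mem_Icc, subset_iff,
    Nat.le_floor_iff (Real.exp_pos Z).le, and_assoc]
  refine and_congr_right fun _ => and_congr_right fun _ => forall₂_congr fun p hp => ?_
  have hpp := Nat.prime_of_mem_primeFactors hp
  constructor
  · rintro ⟨_, h2, _, h3, h4⟩
    exact ⟨(Nat.le_floor_iff' hpp.ne_zero).1 h2, h3, h4⟩
  · rintro ⟨h1, h2, h3⟩
    exact ⟨hpp.one_le, (Nat.le_floor_iff' hpp.ne_zero).2 h1, hpp, h2, h3⟩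

lemma coprime_of_mem_smoothSet {Z J y : ℝ} {k b : ℕ} (hb : b ∈ smoothSet Z J y k) :
    Nat.Coprime k b := by
  rw [mem_smoothSet_iff] at hb
  apply Nat.coprime_of_dvd
  intro p hp h1 h2
  exact (hb.2.2 p (Nat.mem_primeFactors.2 ⟨hp, h2, by omega⟩)).2.2 h1

lemma primeFactors_of_dvd_of_mem_roughSet {X Y J : ℝ} {k a t b p : ℕ} (hak : Nat.gcd a k = 1)
    (ht : t ∈ roughSet X Y J k a) (hb : b ∣ t) (hp : p ∈ b.primeFactors) :
    J < (p : ℝ) ∧ ¬ p ∣ k := by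
  simp only [roughSet, mem_filter, mem_Icc] at ht
  have ht0 : t ≠ 0 := by omega
  have hpt : p ∈ t.primeFactors := Nat.primeFactors_mono hb ht0 hp
  refine ⟨ht.2.2.2.2 p hpt, fun hpk => ?_⟩
  have h1 : Nat.gcd t k = Nat.gcd a k := Nat.ModEq.gcd_eq ht.2.2.2.1
  have h2 : p ∣ Nat.gcd t k := Nat.dvd_gcd (Nat.dvd_of_mem_primeFactors hpt) hpk
  rw [h1, hak] at h2
  exact (Nat.prime_of_mem_primeFactors hp).one_lt.ne' (Nat.dvd_one.1 h2)

lemma mem_apMultiples_of_mem_roughSet {X Y J : ℝ} {k a t b : ℕ}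
    (ht : t ∈ roughSet X Y J k a) (hb : b ∣ t) : t ∈ apMultiples X Y k a b := by
  simp only [roughSet, apMultiples, mem_filter] at ht ⊢
  exact ⟨ht.1, ht.2.1, ht.2.2.1, ht.2.2.2.1, hb⟩

section RoughSums

variable {f : ℕ → ℝ} {x X Y J M Z D l F W : ℝ} {k m R a : ℕ}

lemma RoughSetting.card_siftedSet_le (S : RoughSetting f x X Y J M Z D l F W k m R) {w : ℝ}
    (hw : 1 < w) (hwW : w ≤ W) {b : ℕ} {y : ℝ} (hb : b ∈ smoothSet Z J y k) :
    ((siftedSet X Y w k a b).card : ℝ) ≤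
      Y / (Nat.totient k) * (b : ℝ)⁻¹ * (3 / Real.log w) := by
  have hY : 0 < Y := (Real.exp_pos Z).trans S.exp_Z_lt
  have hb' := mem_smoothSet_iff.1 hb
  have hbpos : (0 : ℝ) < b := by exact_mod_cast hb'.1
  have hl := S.one_le_l
  have hkpos : (0 : ℝ) < k := by exact_mod_cast S.one_le_k
  exact card_rough_quotient_le (a := a) S.one_le_X hY.le S.one_le_k hb'.1
    (coprime_of_mem_smoothSet hb) (by linarith) hw
    ((Real.log_le_log (by linarith) hwW).trans S.log_W_le) S.even_m S.le_m (by
      have h1 : 2 * (w + 1) ^ m ≤ Real.exp Z * Real.exp (-l) := by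
        rw [Real.exp_neg, ← div_eq_mul_inv, le_div_iff₀ (Real.exp_pos l)]
        refine le_trans ?_ S.W_pow_le
        gcongr
      refine h1.trans ?_
      gcongr
      rw [← div_div, le_div_iff₀ hbpos]
      calc Real.exp Z * b ≤ Real.exp Z * Real.exp Z := by gcongr; exact hb'.2.1
        _ = Real.exp (2 * Z) := by rw [← Real.exp_add]; ring_nf
        _ ≤ _ := S.exp_two_Z_le)

lemma RoughSetting.exists_split (S : RoughSetting f x X Y J M Z D l F W k m R)
    (hak : Nat.gcd a k = 1) {t : ℕ} (ht : t ∈ roughSet X Y J k a) :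
    (∃ b ∈ smoothSet Z J x k, t ∈ siftedSet X Y W k a b ∧ f t ≤ f b * M ^ (D * R)) ∨
    (∃ q s : ℕ, q.Prime ∧ ¬ q ∣ k ∧ (q : ℝ) ≤ Real.exp (Z / R) ∧ q ^ s ∣ t ∧
      Real.exp (Z / 2) < (q : ℝ) ^ s) ∨
    (∃ b ∈ smoothSet Z J (Real.exp l) k, Real.exp (Z / 2) < (b : ℝ) ∧ b ∣ t) ∨
    (∃ r : ℕ, R ≤ r ∧ r * l ≤ Z ∧ ∃ b ∈ smoothSet Z J (Real.exp (Z / r)) k,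
      Real.exp (Z / 2) < (b : ℝ) ∧
      t ∈ siftedSet X Y (min W (Real.exp (Z / (r + 1)))) k a b ∧
      f t ≤ f b * M ^ (D * (r + 1))) := by
  have ht1 := ht
  simp only [roughSet, mem_filter, mem_Icc] at ht1
  obtain ⟨⟨ht1', _⟩, htX, htXY, -, -⟩ := ht1
  have ht0 : t ≠ 0 := by omega
  have htpos : (0 : ℝ) < t := by exact_mod_cast ht1'
  have hZ := S.Z_pos
  have hzt : Real.exp Z < t := S.exp_Z_lt.trans_le (S.Y_le_X.trans htX)
  have hRpos : (0 : ℝ) < R := by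
    have := S.four_le_R
    positivity
  obtain ⟨b, q, s, hq, hs, hbq, hbz, hzbq, hbp, hcop, hdp⟩ :=
    exists_prefix_split ht0 (Real.one_le_exp hZ.le) hzt
  have hbt : b ∣ t := (Nat.dvd_mul_right _ _).trans hbq
  have hqt : q ^ s ∣ t := (Nat.dvd_mul_left _ _).trans hbq
  have hb1 : 1 ≤ b := Nat.pos_of_dvd_of_pos hbt ht1'
  have hq1 : (1 : ℝ) < q := by exact_mod_cast hq.one_lt
  have hlq : 0 < Real.log q := Real.log_pos hq1
  have hqk : ¬ q ∣ k := (primeFactors_of_dvd_of_mem_roughSet hak ht hqt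
    (Nat.mem_primeFactors.2 ⟨hq, dvd_pow_self q (by omega), by
      have := hq.pos; positivity⟩)).2
  have hlogt : Real.log (t / b : ℕ) ≤ D * Z := by
    refine le_trans (Real.log_le_log ?_ ?_) S.log_two_x_le
    · exact_mod_cast Nat.div_pos (Nat.le_of_dvd ht1' hbt) hb1
    · have : ((t / b : ℕ) : ℝ) ≤ t := by exact_mod_cast Nat.div_le_self t b
      linarith [S.Y_le_X, S.X_le_x]
  have hDZ : 0 ≤ D * Z := le_trans (Real.log_nonneg (by
    linarith [S.one_le_X, S.X_le_x])) S.log_two_x_le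
  have hft : ∀ c : ℝ, 0 < c → Z / c ≤ Real.log q → f t ≤ f b * M ^ (D * c) := by
    intro c hc hcq
    have e : t = b * (t / b) := (Nat.mul_div_cancel' hbt).symm
    conv_lhs => rw [e]
    rw [S.map_mul _ _ hcop]
    apply mul_le_mul_of_nonneg_left _ (S.nonneg b)
    refine (multiplicative_le_rpow S.nonneg S.map_one S.map_mul S.one_le_M S.pow_le hq1
      (Nat.div_pos (Nat.le_of_dvd ht1' hbt) hb1).ne'
      (fun p hp => by exact_mod_cast hdp p hp)).trans ?_
    apply Real.rpow_le_rpow_of_exponent_le S.one_le_M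
    rw [div_le_iff₀ hlq]
    refine hlogt.trans ?_
    rw [div_le_iff₀ hc] at hcq
    have hD : 0 ≤ D := nonneg_of_mul_nonneg_left hDZ hZ
    calc D * Z ≤ D * (Real.log q * c) := by gcongr
      _ = _ := by ring
  have hmem : ∀ y : ℝ, (∀ p ∈ b.primeFactors, (p : ℝ) ≤ y) → b ∈ smoothSet Z J y k := by
    intro y hy
    exact mem_smoothSet_iff.2 ⟨hb1, hbz, fun p hp =>
      ⟨hy p hp, primeFactors_of_dvd_of_mem_roughSet hak ht hbt hp⟩⟩
  have hsift : ∀ w : ℝ, w < q → t ∈ siftedSet X Y w k a b := by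
    intro w hw
    rw [mem_siftedSet_iff]
    refine ⟨mem_apMultiples_of_mem_roughSet ht hbt, fun p hp hpw _ hbp => ?_⟩
    have h1 : p ∣ t / b := Nat.dvd_div_of_mul_dvd hbp
    have h2 := hdp p (Nat.mem_primeFactors.2 ⟨hp, h1,
      (Nat.div_pos (Nat.le_of_dvd ht1' hbt) hb1).ne'⟩)
    have h3 : (q : ℝ) ≤ p := by exact_mod_cast h2
    linarith
  have hlt : ∀ p ∈ b.primeFactors, (p : ℝ) ≤ q := fun p hp => by exact_mod_cast (hbp p hp).le
  rcases lt_or_ge (Z / R) (Real.log q) with hqR | hqR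
  · left
    refine ⟨b, hmem x ?_, hsift W ?_, hft R hRpos hqR.le⟩
    · intro p hp
      have h1 : (p : ℝ) ≤ b := by exact_mod_cast Nat.le_of_mem_primeFactors hp
      linarith [S.exp_Z_lt, S.Y_le_X, S.X_le_x]
    · rw [← Real.log_lt_log_iff (by linarith [S.one_lt_W]) (by linarith)]
      exact S.log_W_le_div.trans_lt hqR
  right
  have hqexp : ∀ c : ℝ, Real.log q ≤ c → (q : ℝ) ≤ Real.exp c := fun c hc =>
    (Real.log_le_iff_le_exp (by linarith)).1 hc
  rcases le_or_gt (b : ℝ) (Real.exp (Z / 2)) with hb2 | hb2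
  · left
    refine ⟨q, s, hq, hqk, hqexp _ hqR, hqt, ?_⟩
    by_contra hcon
    rw [not_lt] at hcon
    have h1 : (b : ℝ) * (q : ℝ) ^ s ≤ Real.exp (Z / 2) * Real.exp (Z / 2) := by gcongr
    rw [← Real.exp_add, add_halves] at h1
    linarith
  right
  rcases le_or_gt (Real.log q) l with hql | hql
  · left
    exact ⟨b, hmem _ fun p hp => (hlt p hp).trans (hqexp _ hql), hb2, hbt⟩
  right
  have hr0 : 0 ≤ Z / Real.log q := by positivity
  have hr1 := Nat.floor_le hr0
  have hr2 := Nat.lt_floor_add_one (Z / Real.log q)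
  have hRr : R ≤ ⌊Z / Real.log q⌋₊ := by
    apply Nat.le_floor
    rw [le_div_iff₀ hlq]
    rw [le_div_iff₀ hRpos] at hqR
    linarith
  set r := ⌊Z / Real.log q⌋₊
  have hrpos : (0 : ℝ) < r := lt_of_lt_of_le hRpos (by exact_mod_cast hRr)
  rw [le_div_iff₀ hlq] at hr1
  rw [div_lt_iff₀ hlq] at hr2
  have hr3 : Z / (r + 1) < Real.log q := by
    rw [div_lt_iff₀ (by linarith)]
    linarith
  refine ⟨r, hRr, ?_, b, hmem _ fun p hp => (hlt p hp).trans (hqexp _ ?_), hb2, hsift _ ?_,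
    hft _ (by linarith) hr3.le⟩
  · refine le_trans ?_ hr1
    gcongr
  · rw [le_div_iff₀ hrpos]; linarith
  · refine (min_le_right _ _).trans_lt ?_
    rw [← Real.lt_log_iff_exp_lt (by linarith)]
    exact hr3

/-- The elements of `smoothSet Z J y k` exceeding `exp (Z / 2)`. -/
def largeSmoothSet (Z J y : ℝ) (k : ℕ) : Finset ℕ :=
  (smoothSet Z J y k).filter fun b : ℕ => Real.exp (Z / 2) < (b : ℝ)

lemma mem_primesBetween {y : ℝ} {p : ℕ} (h : p ∈ primesBetween J y k) :
    p.Prime ∧ (p : ℝ) ≤ y ∧ J < (p : ℝ) ∧ ¬ p ∣ k := by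
  simp only [primesBetween, mem_filter, mem_Icc] at h
  exact ⟨h.2.1, (Nat.le_floor_iff' (by omega)).1 h.1.2, h.2.2⟩

lemma primesBetween_subset {y y' : ℝ} (h : y ≤ y') :
    primesBetween J y k ⊆ primesBetween J y' k := by
  intro p hp
  simp only [primesBetween, mem_filter, mem_Icc] at hp ⊢
  exact ⟨⟨hp.1.1, hp.1.2.trans (Nat.floor_le_floor h)⟩, hp.2⟩

lemma ne_zero_and_subset_of_mem_smoothSet {y : ℝ} {b : ℕ} (hb : b ∈ smoothSet Z J y k) :
    b ≠ 0 ∧ b.primeFactors ⊆ primesBetween J y k := by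
  simp only [smoothSet, mem_filter, mem_Icc] at hb
  exact ⟨by omega, hb.2⟩

lemma sum_sqrt_inv_le (N : ℕ) : ∑ n ∈ Icc 1 N, (Real.sqrt n)⁻¹ ≤ 2 * Real.sqrt N := by
  induction N with
  | zero => simp
  | succ n ih =>
    rw [sum_Icc_succ_top (by omega)]
    have h0 : (0 : ℝ) ≤ n := Nat.cast_nonneg n
    have h1 := Real.sq_sqrt h0
    have h2 := Real.sq_sqrt (show (0 : ℝ) ≤ ((n + 1 : ℕ) : ℝ) by positivity)
    have h3 : 0 < Real.sqrt ((n + 1 : ℕ) : ℝ) := Real.sqrt_pos.2 (by positivity)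
    have h4 := Real.sqrt_nonneg (n : ℝ)
    push_cast at *
    set u := Real.sqrt (n : ℝ)
    set v := Real.sqrt ((n : ℝ) + 1)
    have h5 : v⁻¹ ≤ 2 * v - 2 * u := by
      rw [inv_le_iff_one_le_mul₀ h3]
      nlinarith [sq_nonneg (v - u)]
    linarith

namespace RoughSetting

lemma J_pos (S : RoughSetting f x X Y J M Z D l F W k m R) : 0 < J := by
  linarith [S.four_le_J]

lemma apply_prime_le (S : RoughSetting f x X Y J M Z D l F W k m R) {p : ℕ} (hp : p.Prime) :
    f p ≤ M := by
  simpa using S.pow_le p hp 1 le_rfl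

lemma exp_Z_lt_x (S : RoughSetting f x X Y J M Z D l F W k m R) : Real.exp Z < x := by
  linarith [S.exp_Z_lt, S.Y_le_X, S.X_le_x]

lemma Y_pos (S : RoughSetting f x X Y J M Z D l F W k m R) : 0 < Y :=
  (Real.exp_pos Z).trans S.exp_Z_lt

lemma mul_rpow_prime_le_half (S : RoughSetting f x X Y J M Z D l F W k m R) {p : ℕ}
    (hp : J < (p : ℝ)) {s : ℝ} (hs : s ≤ -(1 / 2)) : M * (p : ℝ) ^ s ≤ 1 / 2 := by
  have hM := S.one_le_M
  have hJ := S.four_le_J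
  have hp0 : (0 : ℝ) < p := by linarith
  have h1 : (p : ℝ) ^ s ≤ (p : ℝ) ^ (-(1 / 2) : ℝ) :=
    Real.rpow_le_rpow_of_exponent_le (by linarith) hs
  rw [Real.rpow_neg hp0.le, ← Real.sqrt_eq_rpow] at h1
  have h2 : 2 * M ≤ Real.sqrt p := by
    apply Real.le_sqrt_of_sq_le
    nlinarith [S.M_sq_le]
  have h3 : (Real.sqrt p)⁻¹ ≤ (2 * M)⁻¹ := by gcongr
  calc M * (p : ℝ) ^ s ≤ M * (2 * M)⁻¹ := by
        gcongr
        exact h1.trans h3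
    _ = 1 / 2 := by field_simp

lemma sum_sq_le (S : RoughSetting f x X Y J M Z D l F W k m R) (y : ℝ) :
    ∑ p ∈ primesBetween J y k, 2 * M ^ 2 * ((p : ℝ) ^ 2)⁻¹ ≤ 1 := by
  rw [← mul_sum]
  have hJ := S.J_pos
  calc _ ≤ 2 * M ^ 2 * (2 / J) := by
        gcongr
        exact sum_inv_sq_primesBetween_le (by linarith [S.four_le_J]) _ _
    _ = 4 * M ^ 2 / J := by ring
    _ ≤ 1 := (div_le_one hJ).2 S.M_sq_le

lemma sum_smoothSet_le (S : RoughSetting f x X Y J M Z D l F W k m R) :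
    ∑ b ∈ smoothSet Z J x k, f b * (b : ℝ)⁻¹ ≤
      Real.exp (∑ p ∈ primesBetween J x k, f p / p) * Real.exp 1 := by
  have h := sum_multiplicative_rpow_le_exp (s := -1) S.nonneg S.map_one S.map_mul
    (P := primesBetween J x k) (fun p hp => (mem_primesBetween hp).1) (M := M)
    (by linarith [S.one_le_M]) (fun p hp => S.pow_le p (mem_primesBetween hp).1)
    (fun p hp => S.mul_rpow_prime_le_half (mem_primesBetween hp).2.2.1 (by norm_num))
    (smoothSet Z J x k) (fun b hb => ne_zero_and_subset_of_mem_smoothSet hb)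
  simp only [Real.rpow_neg_one] at h
  refine h.trans ?_
  rw [← Real.exp_add, Real.exp_le_exp, sum_add_distrib]
  simp only [div_eq_mul_inv]
  gcongr
  refine le_of_eq_of_le (sum_congr rfl fun p _ => ?_) (S.sum_sq_le x)
  rw [mul_pow, inv_pow]
  ring

lemma log_le_l (S : RoughSetting f x X Y J M Z D l F W k m R) {r : ℕ} (hRr : R ≤ r)
    (hrl : r * l ≤ Z) : Real.log r ≤ l := by
  have hr : (0 : ℝ) < r := by
    have := S.four_le_R
    exact_mod_cast (by omega : 0 < r)
  rw [Real.log_le_iff_le_exp hr]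
  have := S.one_le_l
  nlinarith [S.Z_le]

lemma sum_smoothSet_tail_le (S : RoughSetting f x X Y J M Z D l F W k m R) {r : ℕ} (hRr : R ≤ r)
    (hrl : r * l ≤ Z) :
    ∑ b ∈ largeSmoothSet Z J (Real.exp (Z / r)) k, f b * (b : ℝ)⁻¹ ≤
      Real.exp (∑ p ∈ primesBetween J x k, f p / p) *
        Real.exp (-(r * Real.log r / 4) + M * Real.sqrt r * Real.log r + r) := by
  have hr1 : (1 : ℝ) ≤ r := by
    have := S.four_le_R
    exact_mod_cast (by omega : 1 ≤ r)
  have hr0 : (0 : ℝ) < r := by linarith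
  have hZ := S.Z_pos
  have hM := S.one_le_M
  have hlr := S.log_le_l hRr hrl
  have hlr0 : 0 ≤ Real.log r := Real.log_nonneg hr1
  set δ : ℝ := r * Real.log r / (2 * Z) with hδ
  have hδ0 : 0 ≤ δ := by positivity
  have hδ1 : δ ≤ 1 / 2 := by
    rw [hδ, div_le_iff₀ (by linarith)]
    nlinarith
  have hδZ : δ * (Z / 2) = r * Real.log r / 4 := by rw [hδ]; field_simp; ring
  have hδr : δ * (Z / r) = Real.log r / 2 := by rw [hδ]; field_simp
  set P := primesBetween J (Real.exp (Z / r)) k with hP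
  have h := sum_multiplicative_rpow_le_exp (s := δ - 1) S.nonneg S.map_one S.map_mul
    (P := P) (fun p hp => (mem_primesBetween hp).1) (M := M)
    (by linarith [S.one_le_M]) (fun p hp => S.pow_le p (mem_primesBetween hp).1)
    (fun p hp => S.mul_rpow_prime_le_half (mem_primesBetween hp).2.2.1 (by linarith))
    (smoothSet Z J (Real.exp (Z / r)) k) (fun b hb => ne_zero_and_subset_of_mem_smoothSet hb)
  have h1 : ∑ b ∈ largeSmoothSet Z J (Real.exp (Z / r)) k, f b * (b : ℝ)⁻¹ ≤ Real.exp (-(r * Real.log r / 4)) *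
        ∑ b ∈ smoothSet Z J (Real.exp (Z / r)) k, f b * (b : ℝ) ^ (δ - 1) := by
    rw [mul_sum]
    refine le_trans (sum_le_sum fun b hb => ?_) (sum_le_sum_of_subset_of_nonneg
      (filter_subset _ _) fun b _ _ => mul_nonneg (Real.exp_pos _).le
        (mul_nonneg (S.nonneg b) (Real.rpow_nonneg (Nat.cast_nonneg b) _)))
    have hb := (mem_filter.1 hb).2
    have hb0 : (0 : ℝ) < b := (Real.exp_pos _).trans hb
    have h2 : Real.exp (r * Real.log r / 4) ≤ (b : ℝ) ^ δ := by
      rw [← hδZ, mul_comm, Real.exp_mul]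
      gcongr
    rw [Real.rpow_sub_one hb0.ne', mul_left_comm]
    apply mul_le_mul_of_nonneg_left _ (S.nonneg b)
    rw [Real.exp_neg, div_eq_mul_inv ((b : ℝ) ^ δ), ← mul_assoc]
    apply le_mul_of_one_le_left (by positivity)
    rw [← div_eq_inv_mul]
    exact (one_le_div (Real.exp_pos _)).2 h2
  refine h1.trans ?_
  have hpr : ∀ p ∈ P, f p * (p : ℝ) ^ (δ - 1) + 2 * (M * (p : ℝ) ^ (δ - 1)) ^ 2 ≤
      f p / p + (M * δ * Real.sqrt r) * (Real.log p / p) +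
        r * (2 * M ^ 2 * ((p : ℝ) ^ 2)⁻¹) := by
    intro p hp
    obtain ⟨hpp, hple, hpJ, -⟩ := mem_primesBetween hp
    have hp1 : (1 : ℝ) < p := by exact_mod_cast hpp.one_lt
    have hp0 : (0 : ℝ) < p := by linarith
    have hlp : Real.log p ≤ Z / r := (Real.log_le_iff_le_exp hp0).2 hple
    have hlp0 : 0 ≤ Real.log p := Real.log_nonneg hp1.le
    have hpδ : (p : ℝ) ^ δ ≤ Real.sqrt r := by
      rw [Real.rpow_def_of_pos hp0, Real.sqrt_eq_rpow, Real.rpow_def_of_pos hr0, Real.exp_le_exp]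
      have : Real.log p * δ ≤ Z / r * δ := by gcongr
      linarith
    have hpδ0 : 0 < (p : ℝ) ^ δ := Real.rpow_pos_of_pos hp0 _
    have hpδ1 : (p : ℝ) ^ δ - 1 ≤ δ * Real.log p * Real.sqrt r := by
      have h3 : (p : ℝ) ^ δ - 1 ≤ δ * Real.log p * (p : ℝ) ^ δ := by
        have h4 := Real.add_one_le_exp (-(Real.log p * δ))
        rw [Real.exp_neg, ← Real.rpow_def_of_pos hp0, ← one_div, le_div_iff₀ hpδ0] at h4
        linarith
      refine h3.trans ?_
      gcongr
    have hfp := S.apply_prime_le hpp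
    have hfp0 := S.nonneg p
    rw [Real.rpow_sub_one hp0.ne']
    have e1 : f p * ((p : ℝ) ^ δ / p) ≤ f p / p + (M * δ * Real.sqrt r) * (Real.log p / p) := by
      calc f p * ((p : ℝ) ^ δ / p) = f p / p + f p * ((p : ℝ) ^ δ - 1) / p := by ring
        _ ≤ f p / p + M * (δ * Real.log p * Real.sqrt r) / p := by
            gcongr
            have : 1 ≤ (p : ℝ) ^ δ := Real.one_le_rpow hp1.le hδ0
            linarith
        _ = _ := by ring
    have e2 : 2 * (M * ((p : ℝ) ^ δ / p)) ^ 2 ≤ r * (2 * M ^ 2 * ((p : ℝ) ^ 2)⁻¹) := by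
      calc 2 * (M * ((p : ℝ) ^ δ / p)) ^ 2 ≤ 2 * (M * (Real.sqrt r / p)) ^ 2 := by gcongr
        _ = (Real.sqrt r) ^ 2 * (2 * M ^ 2 * ((p : ℝ) ^ 2)⁻¹) := by
            rw [mul_pow, div_pow]; ring
        _ = _ := by rw [Real.sq_sqrt hr0.le]
    linarith
  have hexp : ∑ p ∈ P, (f p * (p : ℝ) ^ (δ - 1) + 2 * (M * (p : ℝ) ^ (δ - 1)) ^ 2) ≤
      ∑ p ∈ primesBetween J x k, f p / p + M * Real.sqrt r * Real.log r + r := by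
    refine (sum_le_sum hpr).trans ?_
    rw [sum_add_distrib, sum_add_distrib, ← mul_sum, ← mul_sum]
    have i1 : ∑ p ∈ P, f p / p ≤ ∑ p ∈ primesBetween J x k, f p / p := by
      apply sum_le_sum_of_subset_of_nonneg
      · apply primesBetween_subset
        refine le_trans ?_ S.exp_Z_lt_x.le
        exact Real.exp_le_exp.2 (div_le_self hZ.le hr1)
      · intro p _ _
        exact div_nonneg (S.nonneg p) (Nat.cast_nonneg p)
    have i2 : ∑ p ∈ P, Real.log p / p ≤ 2 * (Z / r) := by
      calc ∑ p ∈ P, Real.log p / p ≤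
            ∑ p ∈ Icc 1 ⌊Real.exp (Z / r)⌋₊ with p.Prime, Real.log p / p := by
            apply sum_le_sum_of_subset_of_nonneg
            · intro p hp
              simp only [hP, primesBetween, mem_filter] at hp ⊢
              exact ⟨hp.1, hp.2.1⟩
            · intro p _ _
              exact div_nonneg (Real.log_natCast_nonneg p) (Nat.cast_nonneg p)
        _ ≤ 2 * Real.log ⌊Real.exp (Z / r)⌋₊ := sum_log_div_primes_le _
        _ ≤ 2 * (Z / r) := by
            gcongr
            have hf1 : 1 ≤ ⌊Real.exp (Z / r)⌋₊ :=
              Nat.one_le_floor_iff _ |>.2 (Real.one_le_exp (by positivity))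
            rw [Real.log_le_iff_le_exp (by exact_mod_cast hf1)]
            exact Nat.floor_le (Real.exp_pos _).le
    have i3 := S.sum_sq_le (Real.exp (Z / r))
    have i4 : M * δ * Real.sqrt r * ∑ p ∈ P, Real.log p / p ≤ M * Real.sqrt r * Real.log r := by
      calc M * δ * Real.sqrt r * ∑ p ∈ P, Real.log p / p ≤
            M * δ * Real.sqrt r * (2 * (Z / r)) := by gcongr
        _ = 2 * M * Real.sqrt r * (δ * (Z / r)) := by ring
        _ = _ := by rw [hδr]; ring
    have i5 : (r : ℝ) * ∑ p ∈ P, 2 * M ^ 2 * ((p : ℝ) ^ 2)⁻¹ ≤ r * 1 := by gcongr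
    linarith
  calc _ ≤ Real.exp (-(r * Real.log r / 4)) *
        Real.exp (∑ p ∈ primesBetween J x k, f p / p + M * Real.sqrt r * Real.log r + r) := by
        gcongr
        exact h.trans (Real.exp_le_exp.2 hexp)
    _ = _ := by
        rw [← Real.exp_add, ← Real.exp_add]
        ring_nf

lemma sum_rpow_smoothSet_le (S : RoughSetting f x X Y J M Z D l F W k m R) :
    ∑ b ∈ smoothSet Z J (Real.exp l) k, (b : ℝ) ^ (-(1 / 2) : ℝ) ≤
      Real.exp (4 * Real.exp (l / 2)) := by
  have hJ := S.four_le_J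
  have hhalf : ∀ p : ℕ, J < (p : ℝ) → (p : ℝ) ^ (-(1 / 2) : ℝ) ≤ 1 / 2 := by
    intro p hp
    refine le_trans ?_ (S.mul_rpow_prime_le_half hp le_rfl)
    exact le_mul_of_one_le_left (Real.rpow_nonneg (Nat.cast_nonneg p) _) S.one_le_M
  have h := sum_multiplicative_rpow_le_exp (f := fun _ => (1 : ℝ)) (s := -(1 / 2))
    (fun _ => zero_le_one) rfl (fun _ _ _ => (one_mul 1).symm)
    (P := primesBetween J (Real.exp l) k) (fun p hp => (mem_primesBetween hp).1) (M := 1)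
    zero_le_one (fun p _ j _ => (one_pow j).ge)
    (fun p hp => by rw [one_mul]; exact hhalf p (mem_primesBetween hp).2.2.1)
    (smoothSet Z J (Real.exp l) k) (fun b hb => ne_zero_and_subset_of_mem_smoothSet hb)
  simp only [one_mul] at h
  refine h.trans (Real.exp_le_exp.2 ?_)
  calc _ ≤ ∑ p ∈ primesBetween J (Real.exp l) k, 2 * (Real.sqrt p)⁻¹ := by
        apply sum_le_sum
        intro p hp
        have hpJ := (mem_primesBetween hp).2.2.1
        have h1 := hhalf p hpJ
        have h0 := Real.rpow_nonneg (Nat.cast_nonneg (α := ℝ) p) (-(1 / 2))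
        rw [Real.rpow_neg (Nat.cast_nonneg p), ← Real.sqrt_eq_rpow] at h1 h0 ⊢
        nlinarith
    _ ≤ ∑ n ∈ Icc 1 ⌊Real.exp l⌋₊, 2 * (Real.sqrt n)⁻¹ :=
        sum_le_sum_of_subset_of_nonneg (filter_subset _ _) (by intros; positivity)
    _ ≤ 2 * (2 * Real.sqrt ⌊Real.exp l⌋₊) := by
        rw [← mul_sum]
        gcongr
        exact sum_sqrt_inv_le _
    _ ≤ 2 * (2 * Real.sqrt (Real.exp l)) := by
        gcongr
        exact Nat.floor_le (Real.exp_pos _).le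
    _ = _ := by rw [Real.exp_half]; ring

lemma card_apMultiples_le (S : RoughSetting f x X Y J M Z D l F W k m R) {b : ℕ} (hb : 1 ≤ b)
    (hkb : Nat.Coprime k b) {c : ℝ} (hc : Real.exp (-2 * Z) ≤ c) (hbc : (b : ℝ)⁻¹ ≤ c) :
    ((apMultiples X Y k a b).card : ℝ) ≤ 3 * (Y / k) * c := by
  have h := (abs_le.1 (abs_card_apMultiples_sub_le (a := a) S.one_le_X S.Y_pos.le S.one_le_k hb
    hkb)).2
  have hk : (0 : ℝ) < k := by exact_mod_cast S.one_le_k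
  have hYk : 0 ≤ Y / k := div_nonneg S.Y_pos.le hk.le
  have h1 : Y / (k * b) ≤ Y / k * c := by
    rw [← div_div, div_eq_mul_inv _ (b : ℝ)]
    gcongr
  have h2 : 1 ≤ Y / k * c := by
    calc (1 : ℝ) = Real.exp (2 * Z) * Real.exp (-2 * Z) := by
          rw [← Real.exp_add, ← Real.exp_zero]; ring_nf
      _ ≤ Y / k * c := mul_le_mul S.exp_two_Z_le hc (Real.exp_pos _).le hYk
  linarith

lemma sum_prime_power_le (S : RoughSetting f x X Y J M Z D l F W k m R) {T : Finset ℕ}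
    (hT : ∀ t ∈ T, t ∈ roughSet X Y J k a ∧ ∃ q s : ℕ, q.Prime ∧ ¬ q ∣ k ∧
      (q : ℝ) ≤ Real.exp (Z / R) ∧ q ^ s ∣ t ∧ Real.exp (Z / 2) < (q : ℝ) ^ s) :
    ∑ t ∈ T, f t ≤ 3 * F * (Y / k) * Real.exp (-(Z / 4)) := by
  have hZ := S.Z_pos
  have hF := S.F_nonneg
  have hYk : 0 ≤ Y / k := div_nonneg S.Y_pos.le (Nat.cast_nonneg k)
  set N := ⌊Real.exp (Z / 2)⌋₊ with hN
  have hN0 : N ≠ 0 := by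
    have : 1 ≤ N := Nat.one_le_floor_iff _ |>.2 (Real.one_le_exp (by positivity))
    omega
  set e : ℕ → ℕ := fun q => Nat.log q N + 1
  set I : Finset ℕ := (Icc 1 ⌊Real.exp (Z / R)⌋₊).filter fun q => q.Prime ∧ ¬ q ∣ k
  have h := sum_le_sum_mul_card_of_cover (f := f) I
    (fun q => apMultiples X Y k a (q ^ e q)) (fun _ => F) (fun _ _ => hF) (T := T) (by
      intro t ht
      obtain ⟨htr, q, s, hq, hqk, hqR, hqt, hqs⟩ := hT t ht
      have ht1 := htr
      simp only [roughSet, mem_filter, mem_Icc] at ht1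
      refine ⟨q, mem_filter.2 ⟨mem_Icc.2 ⟨hq.one_le, ?_⟩, hq, hqk⟩, ?_, S.le_F t ht1.1.1⟩
      · exact (Nat.le_floor_iff (Real.exp_pos _).le).2 hqR
      · apply mem_apMultiples_of_mem_roughSet htr
        refine (pow_dvd_pow q ?_).trans hqt
        have h1 : q ^ Nat.log q N ≤ N := Nat.pow_log_le_self q hN0
        have h2 : N < q ^ s := by
          rw [hN, Nat.floor_lt (Real.exp_pos _).le]
          exact_mod_cast hqs
        exact (Nat.pow_lt_pow_iff_right hq.one_lt).1 (h1.trans_lt h2))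
  refine h.trans ?_
  have hq : ∀ q ∈ I, F * ((apMultiples X Y k a (q ^ e q)).card : ℝ) ≤
      F * (3 * (Y / k) * Real.exp (-(Z / 2))) := by
    intro q hq
    simp only [I, mem_filter] at hq
    apply mul_le_mul_of_nonneg_left _ hF
    apply S.card_apMultiples_le (Nat.one_le_pow _ _ hq.2.1.pos)
      (Nat.Coprime.pow_right _ ((Nat.Prime.coprime_iff_not_dvd hq.2.1).2 hq.2.2).symm)
    · exact Real.exp_le_exp.2 (by linarith)
    · rw [Real.exp_neg]
      have h1 : N < q ^ e q := Nat.lt_pow_succ_log_self hq.2.1.one_lt N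
      rw [hN, Nat.floor_lt (Real.exp_pos _).le] at h1
      gcongr
  have hcard : (I.card : ℝ) ≤ Real.exp (Z / 4) := by
    have h1 : I.card ≤ ⌊Real.exp (Z / R)⌋₊ := (card_filter_le _ _).trans (by simp)
    calc (I.card : ℝ) ≤ ⌊Real.exp (Z / R)⌋₊ := by exact_mod_cast h1
      _ ≤ Real.exp (Z / R) := Nat.floor_le (Real.exp_pos _).le
      _ ≤ Real.exp (Z / 4) := by
          gcongr
          exact_mod_cast S.four_le_R
  refine (sum_le_sum hq).trans ?_
  rw [sum_const, nsmul_eq_mul]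
  calc (I.card : ℝ) * (F * (3 * (Y / k) * Real.exp (-(Z / 2)))) ≤
        Real.exp (Z / 4) * (F * (3 * (Y / k) * Real.exp (-(Z / 2)))) := by gcongr
    _ = 3 * F * (Y / k) * (Real.exp (Z / 4) * Real.exp (-(Z / 2))) := by ring
    _ = _ := by rw [← Real.exp_add]; ring_nf

lemma sum_very_smooth_le (S : RoughSetting f x X Y J M Z D l F W k m R) {T : Finset ℕ}
    (hT : ∀ t ∈ T, t ∈ roughSet X Y J k a ∧ ∃ b ∈ smoothSet Z J (Real.exp l) k,
      Real.exp (Z / 2) < (b : ℝ) ∧ b ∣ t) :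
    ∑ t ∈ T, f t ≤ 3 * F * (Y / k) * Real.exp (-(Z / 4)) * Real.exp (4 * Real.exp (l / 2)) := by
  have hZ := S.Z_pos
  have hF := S.F_nonneg
  have hYk : 0 ≤ Y / k := div_nonneg S.Y_pos.le (Nat.cast_nonneg k)
  have h := sum_le_sum_mul_card_of_cover (f := f) (largeSmoothSet Z J (Real.exp l) k)
    (fun b => apMultiples X Y k a b) (fun _ => F) (fun _ _ => hF) (T := T) (by
      intro t ht
      obtain ⟨htr, b, hb, hbZ, hbt⟩ := hT t ht
      have ht1 := htr
      simp only [roughSet, mem_filter, mem_Icc] at ht1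
      exact ⟨b, mem_filter.2 ⟨hb, hbZ⟩, mem_apMultiples_of_mem_roughSet htr hbt,
        S.le_F t ht1.1.1⟩)
  refine h.trans ?_
  have hb : ∀ b ∈ largeSmoothSet Z J (Real.exp l) k, F * ((apMultiples X Y k a b).card : ℝ) ≤
      3 * F * (Y / k) * Real.exp (-(Z / 4)) * (b : ℝ) ^ (-(1 / 2) : ℝ) := by
    intro b hb
    obtain ⟨hb, hbZ⟩ := mem_filter.1 hb
    obtain ⟨hb1, hb2, -⟩ := mem_smoothSet_iff.1 hb
    have hb0 : (0 : ℝ) < b := by exact_mod_cast hb1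
    have hinv : (b : ℝ)⁻¹ ≤ Real.exp (-(Z / 4)) * (b : ℝ) ^ (-(1 / 2) : ℝ) := by
      have e : (b : ℝ)⁻¹ = (b : ℝ) ^ (-(1 / 2) : ℝ) * (b : ℝ) ^ (-(1 / 2) : ℝ) := by
        rw [← Real.rpow_add hb0, ← Real.rpow_neg_one]
        norm_num
      rw [e]
      gcongr
      have h1 : Real.exp (Z / 4) ≤ (b : ℝ) ^ (1 / 2 : ℝ) := by
        calc Real.exp (Z / 4) = Real.exp (Z / 2) ^ (1 / 2 : ℝ) := by
              rw [← Real.exp_mul]; ring_nf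
          _ ≤ _ := by gcongr
      rw [Real.rpow_neg hb0.le, Real.exp_neg]
      gcongr
    have h2 := S.card_apMultiples_le (a := a) hb1 (coprime_of_mem_smoothSet hb)
      (c := Real.exp (-(Z / 4)) * (b : ℝ) ^ (-(1 / 2) : ℝ)) (by
        refine le_trans ?_ hinv
        calc Real.exp (-2 * Z) ≤ Real.exp (-Z) := Real.exp_le_exp.2 (by linarith)
          _ ≤ (b : ℝ)⁻¹ := by
            rw [Real.exp_neg]
            gcongr) hinv
    calc F * ((apMultiples X Y k a b).card : ℝ) ≤
          F * (3 * (Y / k) * (Real.exp (-(Z / 4)) * (b : ℝ) ^ (-(1 / 2) : ℝ))) := by gcongr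
      _ = _ := by ring
  refine (sum_le_sum hb).trans ?_
  rw [← mul_sum]
  gcongr
  refine le_trans ?_ S.sum_rpow_smoothSet_le
  exact sum_le_sum_of_subset_of_nonneg (filter_subset _ _)
    fun b _ _ => Real.rpow_nonneg (Nat.cast_nonneg b) _

lemma sum_large_prime_le (S : RoughSetting f x X Y J M Z D l F W k m R) {T : Finset ℕ}
    (hT : ∀ t ∈ T, ∃ b ∈ smoothSet Z J x k, t ∈ siftedSet X Y W k a b ∧
      f t ≤ f b * M ^ (D * R)) :
    ∑ t ∈ T, f t ≤ Y / (Nat.totient k) * Real.exp (∑ p ∈ primesBetween J x k, f p / p) *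
      (9 * M ^ (D * R) / Real.log W) := by
  have hM : 0 < M := by linarith [S.one_le_M]
  have hMp : 0 < M ^ (D * R) := Real.rpow_pos_of_pos hM _
  have hW := Real.log_pos S.one_lt_W
  have hY := S.Y_pos
  have h := sum_le_sum_mul_card_of_cover (f := f) (smoothSet Z J x k)
    (fun b => siftedSet X Y W k a b) (fun b => f b * M ^ (D * R))
    (fun b _ => mul_nonneg (S.nonneg b) hMp.le) (T := T) hT
  refine h.trans ?_
  calc _ ≤ ∑ b ∈ smoothSet Z J x k, f b * M ^ (D * R) *
        (Y / (Nat.totient k) * (b : ℝ)⁻¹ * (3 / Real.log W)) := by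
        apply sum_le_sum
        intro b hb
        exact mul_le_mul_of_nonneg_left (S.card_siftedSet_le S.one_lt_W le_rfl hb)
          (mul_nonneg (S.nonneg b) hMp.le)
    _ = (Y / (Nat.totient k) * (3 / Real.log W) * M ^ (D * R)) *
        ∑ b ∈ smoothSet Z J x k, f b * (b : ℝ)⁻¹ := by
        rw [mul_sum]
        exact sum_congr rfl fun b _ => by ring
    _ ≤ (Y / (Nat.totient k) * (3 / Real.log W) * M ^ (D * R)) *
        (Real.exp (∑ p ∈ primesBetween J x k, f p / p) * 3) := by
        gcongr
        refine S.sum_smoothSet_le.trans ?_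
        gcongr
        exact Real.exp_one_lt_three.le
    _ = _ := by ring

lemma sum_medium_prime_le (S : RoughSetting f x X Y J M Z D l F W k m R)
    (hR : ∀ r : ℕ, R ≤ r → D * (r + 1) * Real.log M + M * Real.sqrt r * Real.log r + r +
      3 * Real.log r ≤ r * Real.log r / 4) {T : Finset ℕ}
    (hT : ∀ t ∈ T, ∃ r : ℕ, R ≤ r ∧ r * l ≤ Z ∧ ∃ b ∈ smoothSet Z J (Real.exp (Z / r)) k,
      Real.exp (Z / 2) < (b : ℝ) ∧
      t ∈ siftedSet X Y (min W (Real.exp (Z / (r + 1)))) k a b ∧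
      f t ≤ f b * M ^ (D * (r + 1))) :
    ∑ t ∈ T, f t ≤ Y / (Nat.totient k) * Real.exp (∑ p ∈ primesBetween J x k, f p / p) *
      (12 / Real.log W) := by
  have hM : 0 < M := by linarith [S.one_le_M]
  have hlW := Real.log_pos S.one_lt_W
  have hY := S.Y_pos
  have hZ := S.Z_pos
  have hl := S.one_le_l
  have hR4 := S.four_le_R
  have hR4' : (4 : ℝ) ≤ R := by exact_mod_cast hR4
  set E := Real.exp (∑ p ∈ primesBetween J x k, f p / p)
  set w : ℕ → ℝ := fun r => min W (Real.exp (Z / (r + 1))) with hw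
  have hw1 : ∀ r, 1 < w r := fun r => lt_min S.one_lt_W (Real.one_lt_exp_iff.2 (by positivity))
  set I : Finset ℕ := (Icc R ⌊Z / l⌋₊).filter fun r : ℕ => r * l ≤ Z with hI
  have h := sum_le_sum_mul_card_of_cover (f := f)
    (I.sigma fun r => largeSmoothSet Z J (Real.exp (Z / r)) k)
    (fun i => siftedSet X Y (w i.1) k a i.2) (fun i => f i.2 * M ^ (D * ((i.1 : ℝ) + 1)))
    (fun i _ => mul_nonneg (S.nonneg _) (Real.rpow_pos_of_pos hM _).le) (T := T) (by
      intro t ht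
      obtain ⟨r, hRr, hrl, b, hb, hbZ, hbt, hft⟩ := hT t ht
      refine ⟨⟨r, b⟩, mem_sigma.2 ⟨mem_filter.2 ⟨mem_Icc.2 ⟨hRr, ?_⟩, hrl⟩,
        mem_filter.2 ⟨hb, hbZ⟩⟩, hbt, hft⟩
      exact Nat.le_floor ((le_div_iff₀ (by linarith)).2 hrl))
  refine h.trans ?_
  rw [sum_sigma]
  have hr : ∀ r ∈ I, ∑ b ∈ largeSmoothSet Z J (Real.exp (Z / r)) k,
      f b * M ^ (D * ((r : ℝ) + 1)) * ((siftedSet X Y (w r) k a b).card : ℝ) ≤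
      Y / (Nat.totient k) * E * (6 / Real.log W) * ((r : ℝ) ^ 2)⁻¹ := by
    intro r hr
    simp only [hI, mem_filter, mem_Icc] at hr
    obtain ⟨⟨hRr, -⟩, hrl⟩ := hr
    have hRr' : (R : ℝ) ≤ r := by exact_mod_cast hRr
    have hr0 : (0 : ℝ) < r := by linarith
    have hMp : 0 < M ^ (D * ((r : ℝ) + 1)) := Real.rpow_pos_of_pos hM _
    have hlw : 3 / Real.log (w r) ≤ 6 * r / Real.log W := by
      rw [div_le_div_iff₀ (Real.log_pos (hw1 r)) hlW]
      have h1 : Real.log W ≤ 2 * r * Real.log (w r) := by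
        rcases min_choice W (Real.exp (Z / (r + 1))) with hc | hc
        · simp only [hw, hc]
          nlinarith
        · simp only [hw, hc, Real.log_exp]
          refine S.log_W_le_div.trans ?_
          rw [div_le_iff₀ (by linarith)]
          have : Z ≤ 2 * r * Z / (r + 1) := by
            rw [le_div_iff₀ (by linarith)]
            nlinarith
          calc Z ≤ 2 * r * Z / (r + 1) * 1 := by linarith
            _ ≤ 2 * r * Z / (r + 1) * R := by gcongr; linarith
            _ = _ := by ring
      linarith
    calc _ ≤ ∑ b ∈ largeSmoothSet Z J (Real.exp (Z / r)) k, f b * M ^ (D * ((r : ℝ) + 1)) *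
          (Y / (Nat.totient k) * (b : ℝ)⁻¹ * (3 / Real.log (w r))) := by
          apply sum_le_sum
          intro b hb
          exact mul_le_mul_of_nonneg_left (S.card_siftedSet_le (hw1 r) (min_le_left _ _)
            (mem_filter.1 hb).1) (mul_nonneg (S.nonneg b) hMp.le)
      _ = (Y / (Nat.totient k) * (3 / Real.log (w r)) * M ^ (D * ((r : ℝ) + 1))) *
          ∑ b ∈ largeSmoothSet Z J (Real.exp (Z / r)) k, f b * (b : ℝ)⁻¹ := by
          rw [mul_sum]
          exact sum_congr rfl fun b _ => by ring
      _ ≤ (Y / (Nat.totient k) * (6 * r / Real.log W) * M ^ (D * ((r : ℝ) + 1))) *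
          (E * Real.exp (-(r * Real.log r / 4) + M * Real.sqrt r * Real.log r + r)) := by
          gcongr
          · exact sum_nonneg fun b _ => mul_nonneg (S.nonneg b) (by positivity)
          · exact S.sum_smoothSet_tail_le hRr hrl
      _ = Y / (Nat.totient k) * E * (6 * r / Real.log W) *
          Real.exp (D * (r + 1) * Real.log M + (-(r * Real.log r / 4) +
            M * Real.sqrt r * Real.log r + r)) := by
          rw [Real.exp_add (D * (r + 1) * Real.log M), Real.rpow_def_of_pos hM]
          ring_nf
      _ ≤ Y / (Nat.totient k) * E * (6 * r / Real.log W) * Real.exp (-(3 * Real.log r)) := by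
          gcongr
          linarith [hR r hRr]
      _ = _ := by
          have e : Real.exp (-(3 * Real.log r)) = ((r : ℝ) ^ 3)⁻¹ := by
            rw [Real.exp_neg, mul_comm, Real.exp_mul, Real.exp_log hr0]
            norm_cast
          rw [e]
          field_simp
  refine (sum_le_sum hr).trans ?_
  rw [← mul_sum]
  have hsum : ∑ r ∈ I, ((r : ℝ) ^ 2)⁻¹ ≤ 2 := by
    calc ∑ r ∈ I, ((r : ℝ) ^ 2)⁻¹ ≤ ∑ r ∈ Ioo (R - 1) (⌊Z / l⌋₊ + 1), ((r : ℝ) ^ 2)⁻¹ := by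
          apply sum_le_sum_of_subset_of_nonneg
          · intro r hr
            simp only [hI, mem_filter, mem_Icc] at hr
            rw [mem_Ioo]
            omega
          · intros; positivity
      _ ≤ 2 / ((R - 1 : ℕ) + 1) := sum_Ioo_inv_sq_le _ _
      _ ≤ 2 / 1 := by
          gcongr
          linarith [Nat.cast_nonneg (α := ℝ) (R - 1)]
      _ = 2 := by norm_num
  calc _ ≤ Y / (Nat.totient k) * E * (6 / Real.log W) * 2 := by gcongr
    _ = _ := by ring

theorem sum_roughSet_le (S : RoughSetting f x X Y J M Z D l F W k m R)
    (hak : Nat.gcd a k = 1)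
    (hR : ∀ r : ℕ, R ≤ r → D * (r + 1) * Real.log M + M * Real.sqrt r * Real.log r + r +
      3 * Real.log r ≤ r * Real.log r / 4) :
    ∑ t ∈ roughSet X Y J k a, f t ≤
      Y / (Nat.totient k) * Real.exp (∑ p ∈ primesBetween J x k, f p / p) *
        ((9 * M ^ (D * R) + 12) / Real.log W +
          3 * F * Real.exp (-(Z / 4)) * (1 + Real.exp (4 * Real.exp (l / 2)))) := by
  classical
  set T := roughSet X Y J k a with hT
  set E := Real.exp (∑ p ∈ primesBetween J x k, f p / p) with hE
  set A : ℕ → Prop := fun t => ∃ b ∈ smoothSet Z J x k, t ∈ siftedSet X Y W k a b ∧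
    f t ≤ f b * M ^ (D * R) with hA
  set B : ℕ → Prop := fun t => ∃ q s : ℕ, q.Prime ∧ ¬ q ∣ k ∧
    (q : ℝ) ≤ Real.exp (Z / R) ∧ q ^ s ∣ t ∧ Real.exp (Z / 2) < (q : ℝ) ^ s with hB
  set C : ℕ → Prop := fun t => ∃ b ∈ smoothSet Z J (Real.exp l) k,
    Real.exp (Z / 2) < (b : ℝ) ∧ b ∣ t with hC
  set G : ℕ → Prop := fun t => ∃ r : ℕ, R ≤ r ∧ r * l ≤ Z ∧
    ∃ b ∈ smoothSet Z J (Real.exp (Z / r)) k, Real.exp (Z / 2) < (b : ℝ) ∧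
      t ∈ siftedSet X Y (min W (Real.exp (Z / (r + 1)))) k a b ∧
      f t ≤ f b * M ^ (D * (r + 1)) with hG
  have hsplit : ∑ t ∈ T, f t ≤ ∑ t ∈ T with A t, f t + ∑ t ∈ T with B t, f t +
      ∑ t ∈ T with C t, f t + ∑ t ∈ T with G t, f t := by
    simp only [sum_filter]
    rw [← sum_add_distrib, ← sum_add_distrib, ← sum_add_distrib]
    apply sum_le_sum
    intro t ht
    have h0 := S.nonneg t
    have hs : A t ∨ B t ∨ C t ∨ G t := S.exists_split hak ht
    have i1 : 0 ≤ if A t then f t else 0 := by split_ifs <;> simp [h0]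
    have i2 : 0 ≤ if B t then f t else 0 := by split_ifs <;> simp [h0]
    have i3 : 0 ≤ if C t then f t else 0 := by split_ifs <;> simp [h0]
    have i4 : 0 ≤ if G t then f t else 0 := by split_ifs <;> simp [h0]
    rcases hs with h | h | h | h
    · rw [if_pos h] at i1 ⊢; linarith
    · rw [if_pos h] at i2 ⊢; linarith
    · rw [if_pos h] at i3 ⊢; linarith
    · rw [if_pos h] at i4 ⊢; linarith
  have bA : ∑ t ∈ T with A t, f t ≤ _ := S.sum_large_prime_le
    (fun t ht => (mem_filter.1 ht).2)
  have bB : ∑ t ∈ T with B t, f t ≤ _ := S.sum_prime_power_le (a := a)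
    (fun t ht => ⟨(mem_filter.1 ht).1, (mem_filter.1 ht).2⟩)
  have bC : ∑ t ∈ T with C t, f t ≤ _ := S.sum_very_smooth_le (a := a)
    (fun t ht => ⟨(mem_filter.1 ht).1, (mem_filter.1 ht).2⟩)
  have bG : ∑ t ∈ T with G t, f t ≤ _ := S.sum_medium_prime_le hR
    (fun t ht => (mem_filter.1 ht).2)
  have hE1 : 1 ≤ E := Real.one_le_exp (sum_nonneg fun p _ =>
    div_nonneg (S.nonneg p) (Nat.cast_nonneg p))
  have hphi : (0 : ℝ) < Nat.totient k := by exact_mod_cast Nat.totient_pos.2 S.one_le_k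
  have hY := S.Y_pos
  have hF := S.F_nonneg
  have hYk : Y / k ≤ Y / (Nat.totient k) * E := by
    calc Y / k ≤ Y / (Nat.totient k) * 1 := by
          rw [mul_one]
          gcongr
          exact_mod_cast Nat.totient_le k
      _ ≤ _ := by gcongr
  have hQ : 3 * F * (Y / k) * Real.exp (-(Z / 4)) * (1 + Real.exp (4 * Real.exp (l / 2))) ≤
      3 * F * (Y / (Nat.totient k) * E) * Real.exp (-(Z / 4)) *
        (1 + Real.exp (4 * Real.exp (l / 2))) := by gcongr
  calc _ ≤ Y / (Nat.totient k) * E * (9 * M ^ (D * R) / Real.log W) +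
        3 * F * (Y / (Nat.totient k) * E) * Real.exp (-(Z / 4)) *
        (1 + Real.exp (4 * Real.exp (l / 2))) + Y / (Nat.totient k) * E * (12 / Real.log W) := by
        linarith
    _ = _ := by ring

end RoughSetting

end RoughSums

lemma rankin_exponent_le {l γ D r : ℝ} (hl : Real.exp 100 ≤ l) (hγ : 0 ≤ γ) (hγ' : γ ≤ 1 / 100)
 (hDγ : D * γ ≤ 0.1006) (hr : Real.sqrt l ≤ r) :
    D * (r + 1) * Real.log (l ^ γ) + l ^ γ * Real.sqrt r * Real.log r + r + 3 * Real.log r ≤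
      r * Real.log r / 4 := by
  have hl0 : 0 < l := (Real.exp_pos _).trans_le hl
  have hr0 : 0 < r := (Real.sqrt_pos.2 hl0).trans_le hr
  have hlr : l ≤ r ^ 2 := (Real.sqrt_le_left hr0.le).1 hr
  have hlog : Real.log l ≤ 2 * Real.log r := by
    have := Real.log_le_log hl0 hlr
    rwa [Real.log_pow, Nat.cast_ofNat] at this
  have hlogl : 100 ≤ Real.log l := (Real.le_log_iff_exp_le hl0).2 hl
  have hlogr : 50 ≤ Real.log r := by linarith
  have hr676 : 676 ≤ r := by
    have h1 : Real.exp 50 ≤ r := (Real.le_log_iff_exp_le hr0).1 hlogr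
    have h2 : Real.exp 50 = Real.exp 25 * Real.exp 25 := by rw [← Real.exp_add]; norm_num
    have h3 := Real.add_one_le_exp 25
    nlinarith
  have e1 : D * (r + 1) * Real.log (l ^ γ) ≤ 0.206 * (r * Real.log r) := by
    rw [Real.log_rpow hl0]
    calc D * (r + 1) * (γ * Real.log l) = (D * γ) * (r + 1) * Real.log l := by ring
      _ ≤ 0.1006 * (1.02 * r) * (2 * Real.log r) := by
          gcongr
          linarith
      _ ≤ 0.206 * (r * Real.log r) := by
          have : 0 ≤ r * Real.log r := by positivity
          nlinarith
  have e2 : l ^ γ * Real.sqrt r ≤ 0.01 * r := by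
    have h1 : l ^ γ ≤ r ^ (0.02 : ℝ) := by
      calc l ^ γ ≤ (r ^ 2) ^ γ := by gcongr
        _ = r ^ (2 * γ) := by rw [← Real.rpow_natCast, ← Real.rpow_mul hr0.le]; norm_num
        _ ≤ r ^ (0.02 : ℝ) := Real.rpow_le_rpow_of_exponent_le (by linarith) (by linarith)
    have h2 : 100 ≤ r ^ (0.48 : ℝ) := by
      rw [Real.rpow_def_of_pos hr0]
      calc (100 : ℝ) ≤ Real.exp 12 * Real.exp 12 := by
            nlinarith [Real.add_one_le_exp (12 : ℝ)]
        _ = Real.exp 24 := by rw [← Real.exp_add]; norm_num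
        _ ≤ _ := Real.exp_le_exp.2 (by linarith)
    have h3 : r = r ^ (0.02 : ℝ) * Real.sqrt r * r ^ (0.48 : ℝ) := by
      rw [Real.sqrt_eq_rpow, ← Real.rpow_add hr0, ← Real.rpow_add hr0]
      norm_num
    calc l ^ γ * Real.sqrt r ≤ r ^ (0.02 : ℝ) * Real.sqrt r := by gcongr
      _ ≤ 0.01 * (r ^ (0.02 : ℝ) * Real.sqrt r * r ^ (0.48 : ℝ)) := by
          have : 0 < r ^ (0.02 : ℝ) * Real.sqrt r := by positivity
          nlinarith
      _ = 0.01 * r := by rw [← h3]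
  have e3 : l ^ γ * Real.sqrt r * Real.log r ≤ 0.01 * r * Real.log r := by gcongr
  nlinarith

open Filter in
lemma eventually_parameter_bounds {η β γ D ε A : ℝ} (hη : 0 < η) (hβγ : β < γ)
    (hγ : 0 < γ) (hβγ' : β + 2 * γ < 1) (hD : 0 < D) (hε : 0 < ε) :
    ∀ᶠ l : ℝ in atTop, Real.exp 100 ≤ l ∧ 1 + 57 * l ≤ η / 8 * Real.exp l ∧
      l + 4 * Real.exp (l / 2) ≤ η / 32 * Real.exp l ∧ A ≤ l ^ (γ - β) ∧
      4 ≤ l ^ (1 - β - 2 * γ) ∧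
      Real.log l + D * (2 * Real.sqrt l) * (γ * Real.log l) ≤ ε * l := by
  have h1 : ∀ c : ℝ, 0 < c → ∀ᶠ l : ℝ in atTop, l ≤ c * Real.exp l := by
    intro c hc
    have h := (isLittleO_pow_exp_pos_mul_atTop 1 (zero_lt_one (α := ℝ))).bound hc
    filter_upwards [h, eventually_ge_atTop 0] with l hl hl0
    simpa [abs_of_nonneg hl0] using hl
  have h2 : ∀ᶠ l : ℝ in atTop, 256 / η ≤ Real.exp (l / 2) :=
    (Real.tendsto_exp_atTop.comp (tendsto_id.atTop_div_const two_pos)).eventually_ge_atTop _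
  have hc : 0 < ε / (1 + 2 * D * γ) := by positivity
  have h3 := (isLittleO_log_rpow_atTop (show (0 : ℝ) < 1 / 2 by norm_num)).bound hc
  filter_upwards [eventually_ge_atTop (Real.exp 100), h1 (η / 464) (by positivity),
    h1 (η / 64) (by positivity), h2, h3,
    (tendsto_rpow_atTop (sub_pos.2 hβγ)).eventually_ge_atTop A,
    (tendsto_rpow_atTop (show 0 < 1 - β - 2 * γ by linarith)).eventually_ge_atTop 4]
    with l hl a1 a2 a3 a4 a5 a6
  have hl1 : 1 ≤ l := (Real.one_le_exp (by norm_num)).trans hl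
  refine ⟨hl, by linarith, ?_, a5, a6, ?_⟩
  · have e : Real.exp l = Real.exp (l / 2) * Real.exp (l / 2) := by
      rw [← Real.exp_add, add_halves]
    have h4 : 256 ≤ η * Real.exp (l / 2) := by
      rw [div_le_iff₀ hη] at a3
      linarith
    have h5 : 0 < Real.exp (l / 2) := Real.exp_pos _
    nlinarith
  · rw [← Real.sqrt_eq_rpow, Real.norm_of_nonneg (Real.log_nonneg hl1),
      Real.norm_of_nonneg (Real.sqrt_nonneg l), div_mul_eq_mul_div,
      le_div_iff₀ (by positivity)] at a4
    have h4 : 1 ≤ Real.sqrt l := Real.one_le_sqrt.2 hl1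
    have h5 := Real.mul_self_sqrt (show 0 ≤ l by linarith)
    have h6 := Real.log_nonneg hl1
    calc Real.log l + D * (2 * Real.sqrt l) * (γ * Real.log l) ≤
          Real.sqrt l * (Real.log l * (1 + 2 * D * γ)) := by nlinarith
      _ ≤ Real.sqrt l * (ε * Real.sqrt l) := by gcongr
      _ = ε * (Real.sqrt l * Real.sqrt l) := by ring
      _ = ε * l := by rw [h5]

set_option maxHeartbeats 1000000 in
lemma sum_roughSet_le_of_parameter_bounds {α κ β γ ε η D A1 : ℝ} (hα : 0 < α) (hα' : α < 1 / 2)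
    (hκ : 0 < κ) (hκ' : κ < 1 / 2) (hη : η = α * κ) (hβ : 0 < β) (hβ' : β < η / 41)
    (hγ : γ = 1.02 * β) (hD : D = 4.04 / η) (hε : 0 < ε) (hA1 : 0 < A1) {x l A : ℝ}
    (hx : 0 < x) (hA : 0 ≤ A)
    (hlx : Real.exp l = Real.log x) (hl : Real.exp 100 ≤ l)
    (h1 : 1 + 57 * l ≤ η / 8 * Real.exp l) (h2 : l + 4 * Real.exp (l / 2) ≤ η / 32 * Real.exp l)
    (h3 : A1 ≤ l ^ (γ - β)) (h4 : 4 ≤ l ^ (1 - β - 2 * γ))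
    (h5 : Real.log l + D * (2 * Real.sqrt l) * (γ * Real.log l) ≤ ε * l)
    {f : ℕ → ℝ} (hf : MultNonneg f)
    (hfp : ∀ p : ℕ, p.Prime → ∀ j : ℕ, 1 ≤ j → f (p ^ j) ≤ A1 ^ j * l ^ (β * (j : ℝ)))
    (hfn : ∀ n : ℕ, 1 ≤ n → f n ≤ A * x ^ (η / 32))
    {X Y : ℝ} (hY : x ^ (κ / 2) ≤ Y) (hYX : Y ≤ X) (hXx : X ≤ x) {k : ℕ} (hk : 1 ≤ k)
    (hkY : (k : ℝ) < Y ^ (1 - α)) {a : ℕ} (hak : Nat.gcd a k = 1) :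
    ∑ t ∈ roughSet X Y (l ^ (1 - β)) k a, f t ≤
      (9408 / η + 6 * A) * (Y / (Nat.totient k * Real.log x ^ (1 - ε))) *
        Real.exp (∑ p ∈ primesBetween (l ^ (1 - β)) x k, f p / p) := by
  set L := Real.exp l with hL
  have hL0 : 0 < L := Real.exp_pos l
  have hη0 : 0 < η := by rw [hη]; positivity
  have hη4 : η < 1 / 4 := by rw [hη]; nlinarith
  have hl0 : 0 < l := (Real.exp_pos _).trans_le hl
  have hl100 : 100 ≤ l := by linarith [Real.add_one_le_exp (100 : ℝ)]
  have hLl : l + 1 ≤ L := Real.add_one_le_exp l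
  have hγ0 : 0 < γ := by rw [hγ]; positivity
  have hγ' : γ ≤ 1 / 100 := by rw [hγ]; linarith
  have hD0 : 0 < D := by rw [hD]; positivity
  have hDγ : D * γ ≤ 0.1006 := by
    rw [hD, hγ, div_mul_eq_mul_div, div_le_iff₀ hη0]
    linarith
  have hY0 : 0 < Y := (Real.rpow_pos_of_pos hx _).trans_le hY
  have hk0 : (0 : ℝ) < k := by exact_mod_cast hk
  set Z := α / 2 * Real.log Y with hZ
  have hlogY : κ / 2 * L ≤ Real.log Y := by
    have := Real.log_le_log (Real.rpow_pos_of_pos hx _) hY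
    rwa [Real.log_rpow hx, ← hlx] at this
  have hlogY' : Real.log Y ≤ L := by
    rw [hlx]
    exact Real.log_le_log hY0 (hYX.trans hXx)
  have hlogY0 : 0 < Real.log Y := lt_of_lt_of_le (by positivity) hlogY
  have hZη : η / 4 * L ≤ Z := by
    calc η / 4 * L = α / 2 * (κ / 2 * L) := by rw [hη]; ring
      _ ≤ Z := by rw [hZ]; gcongr
  have hZlog : Z < Real.log Y := mul_lt_of_lt_one_left hlogY0 (by linarith)
  have hY1 : 1 < Y := (Real.log_pos_iff hY0.le).1 hlogY0
  have hM1 : 1 ≤ l ^ γ := Real.one_le_rpow (by linarith) hγ0.le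
  have hsq2 := Real.mul_self_sqrt hl0.le
  have hsq10 : 10 ≤ Real.sqrt l := Real.le_sqrt_of_sq_le (by linarith)
  set R := ⌈Real.sqrt l⌉₊ with hR
  have hR1 : Real.sqrt l ≤ R := Nat.le_ceil _
  have hR2 : (R : ℝ) < Real.sqrt l + 1 := Nat.ceil_lt_add_one (by linarith)
  have hR3 : (R : ℝ) ≤ 2 * Real.sqrt l := by linarith
  have hR4 : (R : ℝ) ≤ l := by
    calc (R : ℝ) ≤ 2 * Real.sqrt l := hR3
      _ ≤ Real.sqrt l * Real.sqrt l := by gcongr; linarith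
      _ = l := hsq2
  set c := η / 448 * L / l with hc
  have hc0 : 0 < c := by positivity
  have hcL : c * l = η / 448 * L := by rw [hc]; field_simp
  set m := 2 * ⌈13 * l + 14⌉₊ with hm
  have hm1 : 13 * l + 14 ≤ (⌈13 * l + 14⌉₊ : ℝ) := Nat.le_ceil _
  have hm2 : (⌈13 * l + 14⌉₊ : ℝ) < 13 * l + 14 + 1 := Nat.ceil_lt_add_one (by linarith)
  have hm3 : (m : ℝ) = 2 * (⌈13 * l + 14⌉₊ : ℝ) := by rw [hm]; push_cast; ring
  have hm4 : (m : ℝ) ≤ 56 * l := by linarith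
  have hlog2 := Real.log_two_lt_d9
  have S : RoughSetting f x X Y (l ^ (1 - β)) (l ^ γ) Z D l (A * x ^ (η / 32)) (Real.exp c) k m
      R := by
    refine
      { nonneg := hf.1, map_one := hf.2.1, map_mul := hf.2.2, one_le_M := hM1, pow_le := ?_
        le_F := hfn, F_nonneg := by positivity, one_le_X := by linarith, Y_le_X := hYX
        X_le_x := hXx, one_le_k := hk, Z_pos := by positivity, exp_Z_lt := ?_
        exp_two_Z_le := ?_, Z_le := ?_, log_two_x_le := ?_, one_le_l := by linarith
        four_le_J := ?_, M_sq_le := ?_, even_m := even_two_mul _, le_m := by linarith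
        one_lt_W := Real.one_lt_exp_iff.2 hc0, log_W_le := ?_, W_pow_le := ?_, four_le_R := ?_
        log_W_le_div := ?_ }
    · intro p hp j hj
      refine (hfp p hp j hj).trans ?_
      rw [Real.rpow_mul hl0.le, Real.rpow_natCast, ← mul_pow]
      gcongr
      calc A1 * l ^ β ≤ l ^ (γ - β) * l ^ β := by gcongr
        _ = l ^ γ := by rw [← Real.rpow_add hl0]; ring_nf
    · rwa [← Real.lt_log_iff_exp_lt hY0]
    · rw [le_div_iff₀ hk0]
      calc Real.exp (2 * Z) * k ≤ Y ^ α * Y ^ (1 - α) := by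
            rw [Real.rpow_def_of_pos hY0 α, show 2 * Z = Real.log Y * α by rw [hZ]; ring]
            gcongr
        _ = Y := by rw [← Real.rpow_add hY0]; simp
    · exact hZlog.le.trans hlogY'
    · rw [Real.log_mul two_ne_zero hx.ne', ← hlx]
      calc Real.log 2 + L ≤ 1.01 * L := by linarith
        _ = D * (η / 4 * L) := by rw [hD]; field_simp; norm_num
        _ ≤ D * Z := by gcongr
    · refine h4.trans (Real.rpow_le_rpow_of_exponent_le (by linarith) (by linarith))
    · calc 4 * (l ^ γ) ^ 2 ≤ l ^ (1 - β - 2 * γ) * (l ^ γ) ^ 2 := by gcongr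
        _ = l ^ (1 - β) := by
          rw [← Real.rpow_natCast, ← Real.rpow_mul hl0.le, ← Real.rpow_add hl0]
          push_cast
          ring_nf
    · rw [Real.log_exp, hc, div_le_iff₀ hl0]
      calc η / 448 * L ≤ 1 * L := by gcongr; linarith
        _ ≤ L * l := by rw [mul_comm]; gcongr; linarith
    · have hW : Real.exp c + 1 ≤ Real.exp (c + 1) := by
        have h6 := Real.add_one_le_exp (1 : ℝ)
        have h7 := Real.one_le_exp hc0.le
        calc Real.exp c + 1 ≤ Real.exp c * 2 := by linarith
          _ ≤ Real.exp c * Real.exp 1 := by gcongr; linarith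
          _ = _ := (Real.exp_add _ _).symm
      calc 2 * (Real.exp c + 1) ^ m * Real.exp l ≤
            Real.exp 1 * Real.exp (c + 1) ^ m * Real.exp l := by
            gcongr
            linarith [Real.add_one_le_exp (1 : ℝ)]
        _ = Real.exp (1 + m * (c + 1) + l) := by
            rw [← Real.exp_nat_mul, Real.exp_add, Real.exp_add]
        _ ≤ Real.exp Z := by
            apply Real.exp_le_exp.2
            refine le_trans ?_ hZη
            have : (m : ℝ) * (c + 1) ≤ 56 * l * (c + 1) := by gcongr
            linarith
    · have : (4 : ℝ) ≤ R := by linarith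
      exact_mod_cast this
    · rw [Real.log_exp, le_div_iff₀ (by linarith)]
      calc c * R ≤ c * l := by gcongr
        _ ≤ Z := by rw [hcL]; linarith [mul_pos hη0 hL0]
  have hmain := S.sum_roughSet_le hak (fun r hr => rankin_exponent_le hl hγ0.le hγ' hDγ
    (hR1.trans (by exact_mod_cast hr)))
  refine hmain.trans ?_
  have hLε : 1 ≤ L ^ ε := Real.one_le_rpow (by linarith) hε.le
  have hb1 : l * (l ^ γ) ^ (D * R) ≤ L ^ ε := by
    have hMR : (l ^ γ) ^ (D * R) ≤ (l ^ γ) ^ (D * (2 * Real.sqrt l)) :=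
      Real.rpow_le_rpow_of_exponent_le hM1 (by gcongr)
    calc l * (l ^ γ) ^ (D * R) ≤ l * (l ^ γ) ^ (D * (2 * Real.sqrt l)) := by gcongr
      _ = Real.exp (Real.log l + D * (2 * Real.sqrt l) * (γ * Real.log l)) := by
          rw [Real.exp_add, Real.exp_log hl0, Real.rpow_def_of_pos (by positivity),
            Real.log_rpow hl0]
          ring_nf
      _ ≤ Real.exp (ε * l) := Real.exp_le_exp.2 h5
      _ = L ^ ε := by rw [hL, ← Real.exp_mul, mul_comm]
  have hMR1 : 1 ≤ (l ^ γ) ^ (D * R) := Real.one_le_rpow hM1 (by positivity)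
  have hb2 : (9 * (l ^ γ) ^ (D * R) + 12) / Real.log (Real.exp c) ≤ 9408 / η * (L ^ ε / L) := by
    rw [Real.log_exp]
    calc (9 * (l ^ γ) ^ (D * R) + 12) / c ≤ 21 * (l ^ γ) ^ (D * R) / c := by
          gcongr
          linarith
      _ = 9408 / η * (l * (l ^ γ) ^ (D * R) / L) := by rw [hc]; field_simp; norm_num
      _ ≤ _ := by gcongr
  have hb3 : 3 * (A * x ^ (η / 32)) * Real.exp (-(Z / 4)) * (1 + Real.exp (4 * Real.exp (l / 2))) ≤
      6 * A * (L ^ ε / L) := by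
    have e1 : 1 + Real.exp (4 * Real.exp (l / 2)) ≤ 2 * Real.exp (4 * Real.exp (l / 2)) := by
      linarith [Real.one_le_exp (show 0 ≤ 4 * Real.exp (l / 2) by positivity)]
    have e2 : Real.exp (η / 32 * L + -(Z / 4) + 4 * Real.exp (l / 2)) ≤ L⁻¹ := by
      rw [hL, ← Real.exp_neg]
      apply Real.exp_le_exp.2
      linarith
    calc _ ≤ 3 * (A * x ^ (η / 32)) * Real.exp (-(Z / 4)) *
          (2 * Real.exp (4 * Real.exp (l / 2))) := by gcongr
      _ = 6 * A * Real.exp (η / 32 * L + -(Z / 4) + 4 * Real.exp (l / 2)) := by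
          rw [Real.rpow_def_of_pos hx, ← hlx, Real.exp_add, Real.exp_add]
          ring_nf
      _ ≤ 6 * A * L⁻¹ := by gcongr
      _ ≤ 6 * A * (L ^ ε / L) := by
          rw [div_eq_mul_inv]
          gcongr
          exact le_mul_of_one_le_left (by positivity) hLε
  have hphi : (0 : ℝ) < Nat.totient k := by exact_mod_cast Nat.totient_pos.2 hk
  set E := Real.exp (∑ p ∈ primesBetween (l ^ (1 - β)) x k, f p / p)
  calc _ ≤ Y / (Nat.totient k) * E * (9408 / η * (L ^ ε / L) + 6 * A * (L ^ ε / L)) := by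
        gcongr
    _ = _ := by
        rw [← hlx, Real.rpow_sub hL0, Real.rpow_one]
        field_simp

/-- Theorem 6 (`roughbd`): the sum of `f` over `J`-rough integers in a short
interval of a progression, for `f ∈ M(β)`. -/
theorem rough_sum_bound (α κ β ε : ℝ) (hα : 0 < α) (hα' : α < 1/2)
    (hκ : 0 < κ) (hκ' : κ < 1/2) (hβ : 0 < β) (hβ' : β < α * κ / 41)
    (hε : 0 < ε) (A1 : ℝ) (hA1 : 0 < A1) (A2 A3 : ℝ → ℝ) :
    ∃ C : ℝ, 0 < C ∧ ∃ x0 : ℝ, ∀ x : ℝ, x0 ≤ x →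
      ∀ f : ℕ → ℝ, MultNonneg f → InMβ f x β A1 A2 A3 →
      ∀ X Y : ℝ, x ^ (κ / 2) ≤ Y → Y ≤ X → X ≤ x →
      ∀ k : ℕ, 1 ≤ k → (k : ℝ) < Y ^ (1 - α) →
      ∀ a : ℕ, Nat.gcd a k = 1 →
      ∑ t ∈ (Finset.Icc 1 ⌊X + Y⌋₊).filter
          (fun t : ℕ => X ≤ (t : ℝ) ∧ (t : ℝ) ≤ X + Y ∧ t % k = a % k ∧
            JRough (Jval x β) t), f t
        ≤ C * (Y / ((Nat.totient k : ℝ) * Real.log x ^ (1 - ε))) *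
          Real.exp (∑ p ∈ (Finset.Icc 1 ⌊x⌋₊).filter
              (fun p : ℕ => p.Prime ∧ Jval x β < (p : ℝ) ∧ ¬ p ∣ k),
              f p / (p : ℝ)) := by
  have hη : 0 < α * κ := by positivity
  have hη' : α * κ < 1 / 4 := by nlinarith
  set δ := α * κ / 32 with hδ
  have hδ0 : 0 < δ := by positivity
  set A := |A2 δ| + |A3 δ| with hA
  have hA0 : 0 ≤ A := by positivity
  refine ⟨9408 / (α * κ) + 6 * A, by positivity, ?_⟩
  have hev := (Real.tendsto_log_atTop.comp Real.tendsto_log_atTop).eventually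
    (eventually_parameter_bounds (η := α * κ) (β := β) (γ := 1.02 * β) (D := 4.04 / (α * κ))
      (ε := ε) (A := A1) hη (by linarith) (by linarith) (by linarith) (by positivity) hε)
  obtain ⟨x0, hx0⟩ := Filter.eventually_atTop.1 (hev.and (Filter.eventually_gt_atTop 1))
  refine ⟨x0, fun x hx f hf hfM X Y hY hYX hXx k hk hkY a hak => ?_⟩
  obtain ⟨⟨g0, g1, g2, g3, g4, g5⟩, hx1⟩ := hx0 x hx
  have hlx : 0 < Real.log x := Real.log_pos hx1
  have hxpos : 0 < x := by linarith
  have hfn : ∀ n : ℕ, 1 ≤ n → f n ≤ A * x ^ δ := by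
    intro n hn
    have hxδ : 0 < x ^ δ := Real.rpow_pos_of_pos hxpos δ
    have hlogx : Real.log x ^ δ ≤ x ^ δ := by
      gcongr
      exact Real.log_le_self hxpos.le
    have b2 := abs_nonneg (A2 δ)
    have b3 := abs_nonneg (A3 δ)
    refine (hfM.2 δ hδ0 n hn).trans (max_le ?_ ?_)
    · gcongr
      linarith [le_abs_self (A2 δ)]
    · calc A3 δ * Real.log x ^ δ ≤ |A3 δ| * Real.log x ^ δ := by
            gcongr
            exact le_abs_self _
        _ ≤ A * x ^ δ := by
            gcongr
            linarith
  exact sum_roughSet_le_of_parameter_bounds hα hα' hκ hκ' rfl hβ hβ' rfl rfl hε hA1 hxpos hA0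
    (Real.exp_log hlx) g0 g1 g2 g3 g4 g5 hf hfM.1 hfn hY hYX hXx hk hkY hak
end
end

section
/- Fix 0 < β < 1/5, a constant A1 > 0, and functions A2, A3 : (0,∞) → (0,∞). Then there exist a constant C > 0 and a threshold z0 such that for all x ≥ z ≥ z0, every nonnegative multiplicative f in M(β) relative to x, every integer k ≥ 1, and every real r with 1 ≤ r ≤ (log z)/(4 log log z): ∑ f(n)/n, taken over all J-rough integers n with n ≥ z^{1/2}, gcd(n,k) = 1, and largest prime factor p(n) ≤ z^{1/r}, is at most C · exp(−(1/2)(1 − (5/4)β) r log r + ∑_{J < p ≤ z^{1/r} prime, p ∤ k} f(p)/p + 2 A1 (log log x)^β r^{1 − (5/4)β}), where J = (log log x)^{1−β}; the constant C is uniform in k and r. -/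
open Finset

noncomputable section

/-- The upper bound in Mertens' first theorem. -/
theorem sum_log_prime_div_le (n : ℕ) :
    ∑ p ∈ (Icc 1 n).filter Nat.Prime, Real.log p / p ≤ Real.log n + Real.log 4 := by
  rcases Nat.eq_zero_or_pos n with rfl | hn
  · simpa using Real.log_nonneg (by norm_num : (1 : ℝ) ≤ 4)
  have hn' : (0 : ℝ) < n := by exact_mod_cast hn
  have hdvd : ∏ p ∈ (Icc 1 n).filter Nat.Prime, p ^ (n / p) ∣ n.factorial := by
    apply Finset.prod_dvd_of_isRelPrime
    · intro p hp q hq hpq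
      simp only [coe_filter, Set.mem_ofPred_eq] at hp hq
      exact Nat.coprime_iff_isRelPrime.mp
        (Nat.coprime_pow_primes _ _ hp.2 hq.2 hpq)
    · intro p hp
      have hpp := (mem_filter.mp hp).2
      rw [hpp.pow_dvd_factorial_iff (b := Nat.log p n + 2) (by omega)]
      calc n / p = n / p ^ 1 := by rw [pow_one]
        _ ≤ _ := single_le_sum (f := fun i => n / p ^ i) (fun _ _ => Nat.zero_le _)
          (by simp)
  have hle : ∏ p ∈ (Icc 1 n).filter Nat.Prime, p ^ (n / p) ≤ n ^ n :=
    (Nat.le_of_dvd n.factorial_pos hdvd).trans n.factorial_le_pow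
  have hlog : ∑ p ∈ (Icc 1 n).filter Nat.Prime, ((n / p : ℕ) : ℝ) * Real.log p
      ≤ n * Real.log n := by
    have hpos : ∀ p ∈ (Icc 1 n).filter Nat.Prime, (0 : ℝ) < (p : ℝ) ^ (n / p) := fun p hp =>
      pow_pos (by exact_mod_cast (mem_filter.mp hp).2.pos) _
    have h := Real.log_le_log (prod_pos hpos)
      (by exact_mod_cast hle : ∏ p ∈ (Icc 1 n).filter Nat.Prime, (p : ℝ) ^ (n / p) ≤ (n : ℝ) ^ n)
    rw [Real.log_prod (fun p hp => (hpos p hp).ne')] at h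
    simpa only [Real.log_pow] using h
  have htheta : ∑ p ∈ (Icc 1 n).filter Nat.Prime, Real.log p ≤ Real.log 4 * n := by
    have h := Chebyshev.theta_le_log4_mul_x hn'.le
    rw [Chebyshev.theta_eq_theta_coe_floor, Nat.floor_natCast] at h
    rwa [Chebyshev.theta, Nat.floor_natCast, ← Finset.Icc_add_one_left_eq_Ioc] at h
  have hterm : ∀ p ∈ (Icc 1 n).filter Nat.Prime,
      n * (Real.log p / p) ≤ ((n / p : ℕ) : ℝ) * Real.log p + Real.log p := by
    intro p hp
    have hpos : (0 : ℝ) < p := by exact_mod_cast (mem_filter.mp hp).2.pos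
    have hlog0 : 0 ≤ Real.log p := Real.log_natCast_nonneg p
    have h1 : (n : ℝ) / p ≤ ((n / p : ℕ) : ℝ) + 1 := by
      rw [← Nat.floor_div_eq_div (K := ℝ)]
      exact (Nat.lt_floor_add_one _).le
    calc n * (Real.log p / p) = (n / p : ℝ) * Real.log p := by ring
      _ ≤ (((n / p : ℕ) : ℝ) + 1) * Real.log p := by gcongr
      _ = _ := by ring
  have hsum := sum_le_sum hterm
  rw [← mul_sum, sum_add_distrib] at hsum
  refine le_of_mul_le_mul_left ?_ hn'
  linarith

/-- A multiplicative function whose values at prime powers are dominated by a geometric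
progression has a sum over `s`-factored integers bounded by an exponential. -/
theorem sum_factoredNumbers_le_exp {s T : Finset ℕ} {F : ℕ → ℝ} {q : ℕ → ℝ}
    (hs : ∀ p ∈ s, p.Prime) (hF : ∀ n, 0 ≤ F n) (hF1 : F 1 = 1)
    (hmul : ∀ m n : ℕ, Nat.Coprime m n → F (m * n) = F m * F n)
    (hq0 : ∀ p ∈ s, 0 ≤ q p) (hq : ∀ p ∈ s, q p ≤ 1 / 2)
    (hFq : ∀ p ∈ s, ∀ l : ℕ, 1 ≤ l → F (p ^ l) ≤ q p ^ l)
    (hT : ∀ n ∈ T, n ∈ Nat.factoredNumbers s) :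
    ∑ n ∈ T, F n ≤ Real.exp (∑ p ∈ s, (F p + 2 * q p ^ 2)) := by
  obtain ⟨G, hG⟩ : ∃ G : ℕ → ℝ, G = (Nat.factoredNumbers s).indicator F := ⟨_, rfl⟩
  have hmem : ∀ n, n ≠ 0 → (n ∈ Nat.factoredNumbers s ↔ n.primeFactors ⊆ s) := fun n hn =>
    ⟨fun h => Nat.primeFactors_subset_of_mem_factoredNumbers h,
      fun h => Nat.mem_factoredNumbers_of_primeFactors_subset hn h⟩
  have h1mem : 1 ∈ Nat.factoredNumbers s := (hmem 1 one_ne_zero).2 (by simp)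
  have hG1 : G 1 = 1 := by rw [hG, Set.indicator_of_mem h1mem, hF1]
  have hG0 : ∀ n, 0 ≤ G n := fun n => hG ▸ Set.indicator_nonneg (fun _ _ => hF _) n
  have hGmul : ∀ {m n : ℕ}, Nat.Coprime m n → G (m * n) = G m * G n := by
    intro m n hmn
    by_cases h : m * n ∈ Nat.factoredNumbers s
    · have h1 := Nat.mem_factoredNumbers_of_dvd h (Dvd.intro _ rfl)
      have h2 := Nat.mem_factoredNumbers_of_dvd h (Dvd.intro_left _ rfl)
      simp only [hG, Set.indicator_of_mem h, Set.indicator_of_mem h1, Set.indicator_of_mem h2]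
      exact hmul m n hmn
    · have : m ∉ Nat.factoredNumbers s ∨ n ∉ Nat.factoredNumbers s := by
        by_contra! hc
        exact h (Nat.mul_mem_factoredNumbers hc.1 hc.2)
      rcases this with h' | h' <;> simp [hG, Set.indicator_of_notMem h, Set.indicator_of_notMem h']
  have hGF : ∀ n, G n ≤ F n := fun n => hG ▸ Set.indicator_le_self' (fun _ _ => hF _) n
  have hGle : ∀ p ∈ s, ∀ l, G (p ^ l) ≤ q p ^ l := by
    intro p hp l
    rcases Nat.eq_zero_or_pos l with rfl | hl
    · simp [hG1]
    · exact (hGF _).trans (hFq p hp l hl)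
  have hgeom : ∀ p ∈ s, Summable (fun l : ℕ => q p ^ l) := fun p hp =>
    summable_geometric_of_lt_one (hq0 p hp) (by linarith [hq p hp])
  have hsumm : ∀ p ∈ s, Summable (fun l : ℕ => G (p ^ l)) := fun p hp =>
    Summable.of_nonneg_of_le (fun _ => hG0 _) (hGle p hp) (hgeom p hp)
  have hsum : ∀ {p : ℕ}, p.Prime → Summable (fun l : ℕ => ‖G (p ^ l)‖) := by
    intro p hp
    by_cases hps : p ∈ s
    · simpa only [Real.norm_of_nonneg (hG0 _)] using hsumm p hps
    · refine summable_of_ne_finset_zero (s := {0}) fun l hl => ?_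
      rw [norm_eq_zero, hG]
      refine Set.indicator_of_notMem (fun h => hps ?_) _
      have hl' : l ≠ 0 := by simpa using hl
      exact (hmem _ (pow_ne_zero _ hp.ne_zero)).1 h
        (by rw [Nat.primeFactors_prime_pow hl' hp]; simp)
  obtain ⟨-, hhas⟩ :=
    EulerProduct.summable_and_hasSum_factoredNumbers_prod_filter_prime_tsum hG1 hGmul hsum s
  rw [filter_true_of_mem hs] at hhas
  have hhas' := hasSum_subtype_iff_indicator.1 hhas
  have hGG : (Nat.factoredNumbers s).indicator G = G := by
    rw [hG, Set.indicator_indicator, Set.inter_self]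
  rw [hGG] at hhas'
  calc ∑ n ∈ T, F n = ∑ n ∈ T, G n :=
        sum_congr rfl fun n hn => by rw [hG, Set.indicator_of_mem (hT n hn)]
    _ ≤ ∏ p ∈ s, ∑' l : ℕ, G (p ^ l) := sum_le_hasSum T (fun n _ => hG0 n) hhas'
    _ ≤ ∏ p ∈ s, Real.exp (F p + 2 * q p ^ 2) := by
        refine prod_le_prod (fun p _ => tsum_nonneg fun _ => hG0 _) fun p hp => ?_
        have hsplit := (hsumm p hp).sum_add_tsum_nat_add 2
        have htail : ∑' l : ℕ, G (p ^ (l + 2)) ≤ 2 * q p ^ 2 := by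
          calc ∑' l : ℕ, G (p ^ (l + 2)) ≤ ∑' l : ℕ, q p ^ 2 * q p ^ l := by
                refine Summable.tsum_le_tsum (fun l => ?_)
                  ((summable_nat_add_iff 2).2 (hsumm p hp)) ((hgeom p hp).mul_left _)
                calc G (p ^ (l + 2)) ≤ q p ^ (l + 2) := hGle p hp _
                  _ = _ := by ring
            _ = q p ^ 2 * (1 - q p)⁻¹ := by
                rw [tsum_mul_left, tsum_geometric_of_lt_one (hq0 p hp) (by linarith [hq p hp])]
            _ ≤ q p ^ 2 * (1 / 2)⁻¹ := by
                gcongr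
                linarith [hq p hp]
            _ = _ := by ring
        have hGp := hGF p
        simp only [sum_range_succ, range_zero, sum_empty, pow_zero, pow_one, hG1] at hsplit
        have := Real.add_one_le_exp (F p + 2 * q p ^ 2)
        linarith
    _ = _ := (Real.exp_sum _ _).symm

/-- A weighted form of Mertens' bound: the Rankin shift costs at most `2 * R`. -/
theorem sum_rpow_log_div_log_sub_one_div_le {y R : ℝ} (hy : 1 < y)
    (hy4 : Real.log 4 ≤ Real.log y) (hR : 1 ≤ R) {s : Finset ℕ}
    (hs : s ⊆ (Icc 1 ⌊y⌋₊).filter Nat.Prime) :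
    ∑ p ∈ s, (R ^ (Real.log p / Real.log y) - 1) / p ≤ 2 * R := by
  have hly : 0 < Real.log y := Real.log_pos hy
  have hfl : (1 : ℝ) ≤ (⌊y⌋₊ : ℝ) := by exact_mod_cast Nat.le_floor (by simpa using hy.le)
  calc ∑ p ∈ s, (R ^ (Real.log p / Real.log y) - 1) / p
      ≤ ∑ p ∈ s, (R - 1) / Real.log y * (Real.log p / p) := by
        refine sum_le_sum fun p hp => ?_
        have hp' := mem_filter.mp (hs hp)
        have hp0 : (0 : ℝ) < p := by exact_mod_cast hp'.2.pos
        have hpy : (p : ℝ) ≤ y :=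
          (Nat.cast_le.2 (mem_Icc.mp hp'.1).2).trans (Nat.floor_le (by linarith))
        have h := rpow_one_add_le_one_add_mul_self (s := R - 1) (by linarith)
          (p := Real.log p / Real.log y) (div_nonneg (Real.log_natCast_nonneg p) hly.le)
          ((div_le_one hly).2 (Real.log_le_log hp0 hpy))
        rw [add_sub_cancel] at h
        calc (R ^ (Real.log p / Real.log y) - 1) / p
            ≤ (Real.log p / Real.log y * (R - 1)) / p := by gcongr; linarith
          _ = _ := by ring
    _ = (R - 1) / Real.log y * ∑ p ∈ s, Real.log p / p := (mul_sum _ _ _).symm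
    _ ≤ (R - 1) / Real.log y * (2 * Real.log y) := by
        refine mul_le_mul_of_nonneg_left ?_ (div_nonneg (by linarith) hly.le)
        calc ∑ p ∈ s, Real.log p / p
            ≤ ∑ p ∈ (Icc 1 ⌊y⌋₊).filter Nat.Prime, Real.log p / p :=
              sum_le_sum_of_subset_of_nonneg hs fun p _ _ =>
                div_nonneg (Real.log_natCast_nonneg p) p.cast_nonneg
          _ ≤ Real.log ⌊y⌋₊ + Real.log 4 := sum_log_prime_div_le _
          _ ≤ Real.log y + Real.log y :=
              add_le_add (Real.log_le_log (by linarith) (Nat.floor_le (by linarith))) hy4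
          _ = _ := by ring
    _ = 2 * (R - 1) := by field_simp
    _ ≤ 2 * R := by linarith

/-- Lemma 7.1 (`lemmalogr`): Rankin-type bound for the sum of `f(n)/n` over
`J`-rough `n ≥ z^(1/2)` coprime to `k` whose largest prime factor is
at most `z^(1/r)`, for `f ∈ M(β)`; uniform in `k` and `r`. -/
theorem rankin_rough_bound (β : ℝ) (hβ : 0 < β) (hβ' : β < 1/5)
    (A1 : ℝ) (hA1 : 0 < A1) (A2 A3 : ℝ → ℝ) :
    ∃ C : ℝ, 0 < C ∧ ∃ z0 : ℝ, ∀ z : ℝ, z0 ≤ z → ∀ x : ℝ, z ≤ x →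
      ∀ f : ℕ → ℝ, MultNonneg f → InMβ f x β A1 A2 A3 →
      ∀ k : ℕ, 1 ≤ k →
      ∀ r : ℝ, 1 ≤ r → r ≤ Real.log z / (4 * Real.log (Real.log z)) →
      (∑' n : ℕ, if z ^ ((2 : ℝ)⁻¹) ≤ (n : ℝ) ∧ Nat.Coprime n k ∧
            JRough (Jval x β) n ∧ (∀ p ∈ n.primeFactors, (p : ℝ) ≤ z ^ r⁻¹)
          then f n / (n : ℝ) else 0)
        ≤ C * Real.exp (-(1/2) * (1 - 5/4 * β) * r * Real.log r
            + (∑ p ∈ (Finset.Icc 1 ⌊z ^ r⁻¹⌋₊).filter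
                (fun p : ℕ => p.Prime ∧ Jval x β < (p : ℝ) ∧ ¬ p ∣ k),
                f p / (p : ℝ))
            + 2 * A1 * Real.log (Real.log x) ^ β * r ^ (1 - 5/4 * β)) := by
  set γ : ℝ := 1 - 5 / 4 * β with hγ
  set η : ℝ := (1 - 5 * β) / (2 * (1 - β)) with hη
  have hβ1 : 0 < 1 - β := by linarith
  have hη0 : 0 < η := div_pos (by linarith) (by linarith)
  have hηβ : (1 - β) * (1 / 2 - η) = 2 * β := by
    rw [hη]; field_simp; ring
  have hη2 : 0 ≤ 1 / 2 - η := by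
    by_contra! h
    nlinarith
  have hKsum : Summable (fun n : ℕ => (n : ℝ) ^ (-(1 + η))) :=
    Real.summable_nat_rpow.2 (by linarith)
  set K : ℝ := ∑' n : ℕ, (n : ℝ) ^ (-(1 + η)) with hK
  obtain ⟨L0, hL0, hL1⟩ : ∃ L0 : ℝ, (∀ L, L0 ≤ L → A1 * L ^ (-(3 / 4 - 7 / 4 * β)) ≤ 1 / 2) ∧
      1 ≤ L0 := by
    have ht := (tendsto_rpow_neg_atTop (y := 3 / 4 - 7 / 4 * β) (by linarith)).const_mul A1
    rw [mul_zero] at ht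
    obtain ⟨a, ha⟩ := Filter.eventually_atTop.1
      (ht.eventually (eventually_le_nhds (by norm_num : (0 : ℝ) < 1 / 2)))
    exact ⟨max a 1, fun L hL => ha L ((le_max_left _ _).trans hL), le_max_right _ _⟩
  refine ⟨Real.exp (2 * A1 ^ 2 * K), Real.exp_pos _, Real.exp (Real.exp L0), ?_⟩
  intro z hz x hzx f hf hfM k _ r hr1 hr
  obtain ⟨hf0, hf1, hfmul⟩ := hf
  obtain ⟨hfp, -⟩ := hfM
  have hz0 : 0 < z := (Real.exp_pos _).trans_le hz
  have hlz : Real.exp L0 ≤ Real.log z := (Real.le_log_iff_exp_le hz0).2 hz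
  have hlz0 : 0 < Real.log z := (Real.exp_pos _).trans_le hlz
  have hllz : L0 ≤ Real.log (Real.log z) := (Real.le_log_iff_exp_le hlz0).2 hlz
  have hLL : L0 ≤ Real.log (Real.log x) :=
    hllz.trans (Real.log_le_log hlz0 (Real.log_le_log hz0 hzx))
  set L : ℝ := Real.log (Real.log x) with hL
  have hLpos : 0 < L := by linarith
  set J : ℝ := Jval x β with hJ
  have hJL : J = L ^ (1 - β) := rfl
  have hJ0 : 0 < J := hJL ▸ Real.rpow_pos_of_pos hLpos _
  have hr0 : 0 < r := by linarith
  have hr4 : 4 * Real.log (Real.log z) ≤ Real.log z / r := by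
    rw [le_div_iff₀ (by linarith)] at hr
    rw [le_div_iff₀ hr0]
    linarith
  set y : ℝ := z ^ r⁻¹ with hy
  have hly : Real.log y = Real.log z / r := by
    rw [hy, Real.log_rpow hz0]; ring
  have hlog4 : Real.log 4 ≤ Real.log y := by
    have := Real.log_le_sub_one_of_pos (by norm_num : (0 : ℝ) < 4)
    linarith
  have hy0 : 0 < y := Real.rpow_pos_of_pos hz0 _
  have hy1 : 1 < y := (Real.log_pos_iff hy0.le).1 (by linarith)
  have hlr0 : 0 ≤ Real.log r := Real.log_nonneg hr1
  set R : ℝ := r ^ γ with hR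
  have hR1 : 1 ≤ R := Real.one_le_rpow hr1 (by linarith)
  set δ : ℝ := γ * r * Real.log r / Real.log z with hδ
  have hδ0 : 0 ≤ δ := by
    have : 0 ≤ γ := by linarith
    positivity
  have hδz : δ * Real.log z = γ * r * Real.log r := by rw [hδ]; field_simp
  have hδ4 : δ ≤ 1 / 4 := by
    have h4 : 4 * Real.log (Real.log z) * r ≤ Real.log z := (le_div_iff₀ hr0).1 hr4
    have hrz : r ≤ Real.log z := by nlinarith
    have h1 : Real.log r ≤ Real.log (Real.log z) := Real.log_le_log hr0 hrz
    have h2 : r * Real.log r ≤ Real.log z / 4 := by nlinarith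
    have h3 : γ * (r * Real.log r) ≤ 1 * (r * Real.log r) := by
      gcongr
      linarith
    rw [hδ, div_le_iff₀ hlz0]
    linarith
  have hpδ : ∀ p : ℕ, p.Prime → (p : ℝ) ^ δ = R ^ (Real.log p / Real.log y) := by
    intro p hp
    have hp0 : (0 : ℝ) < p := by exact_mod_cast hp.pos
    rw [hR, ← Real.rpow_mul hr0.le, Real.rpow_def_of_pos hp0, Real.rpow_def_of_pos hr0, hly, hδ]
    congr 1
    field_simp
  set s : Finset ℕ := (Icc 1 ⌊y⌋₊).filter (fun p : ℕ => p.Prime ∧ J < (p : ℝ) ∧ ¬ p ∣ k) with hs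
  have hsp : ∀ p ∈ s, p.Prime := fun p hp => (mem_filter.mp hp).2.1
  have hsJ : ∀ p ∈ s, J ≤ (p : ℝ) := fun p hp => (mem_filter.mp hp).2.2.1.le
  have hs0 : ∀ p ∈ s, (0 : ℝ) < p := fun p hp => by exact_mod_cast (hsp p hp).pos
  set q : ℕ → ℝ := fun p => A1 * L ^ β * (p : ℝ) ^ (-(3 / 4) : ℝ) with hq
  set F : ℕ → ℝ := fun n => f n * (n : ℝ) ^ (δ - 1) with hF
  have hqhalf : ∀ p ∈ s, q p ≤ 1 / 2 := by
    intro p hp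
    calc q p ≤ A1 * L ^ β * J ^ (-(3 / 4) : ℝ) := by
          simp only [hq]
          exact mul_le_mul_of_nonneg_left
            (Real.rpow_le_rpow_of_nonpos hJ0 (hsJ p hp) (by norm_num)) (by positivity)
      _ = A1 * L ^ (-(3 / 4 - 7 / 4 * β)) := by
          rw [hJL, ← Real.rpow_mul hLpos.le, mul_assoc, ← Real.rpow_add hLpos]
          ring_nf
      _ ≤ 1 / 2 := hL0 L hLL
  have hFq : ∀ p ∈ s, ∀ l : ℕ, 1 ≤ l → F (p ^ l) ≤ q p ^ l := by
    intro p hp l hl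
    have hp1 : (1 : ℝ) ≤ (p : ℝ) ^ l := one_le_pow₀ (by exact_mod_cast (hsp p hp).one_le)
    calc F (p ^ l) = f (p ^ l) * ((p : ℝ) ^ l) ^ (δ - 1) := by simp [hF]
      _ ≤ (A1 ^ l * L ^ (β * (l : ℝ))) * ((p : ℝ) ^ l) ^ (-(3 / 4) : ℝ) := by
          gcongr
          · exact hfp p (hsp p hp) l hl
          · linarith
      _ = q p ^ l := by
          rw [Real.rpow_mul_natCast hLpos.le, ← Real.rpow_pow_comm (hs0 p hp).le]
          simp only [hq]
          ring
  have hqsum : ∑ p ∈ s, q p ^ 2 ≤ A1 ^ 2 * K := by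
    calc ∑ p ∈ s, q p ^ 2 ≤ ∑ p ∈ s, A1 ^ 2 * (p : ℝ) ^ (-(1 + η)) := by
          refine sum_le_sum fun p hp => ?_
          have hsq : q p ^ 2
              = A1 ^ 2 * L ^ (2 * β) * ((p : ℝ) ^ (-(1 / 2 - η)) * (p : ℝ) ^ (-(1 + η))) := by
            simp only [hq]
            rw [mul_pow, mul_pow, ← Real.rpow_mul_natCast hLpos.le,
              ← Real.rpow_mul_natCast (hs0 p hp).le, ← Real.rpow_add (hs0 p hp)]
            push_cast
            ring_nf
          calc q p ^ 2
              ≤ A1 ^ 2 * L ^ (2 * β) * (J ^ (-(1 / 2 - η)) * (p : ℝ) ^ (-(1 + η))) := by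
                rw [hsq]
                refine mul_le_mul_of_nonneg_left (mul_le_mul_of_nonneg_right ?_ ?_) ?_
                · exact Real.rpow_le_rpow_of_nonpos hJ0 (hsJ p hp) (by linarith)
                · positivity
                · positivity
            _ = A1 ^ 2 * (L ^ (2 * β) * L ^ ((1 - β) * -(1 / 2 - η))) * (p : ℝ) ^ (-(1 + η)) := by
                rw [hJL, ← Real.rpow_mul hLpos.le]
                ring
            _ = A1 ^ 2 * (p : ℝ) ^ (-(1 + η)) := by
                rw [← Real.rpow_add hLpos, mul_neg, hηβ, add_neg_cancel, Real.rpow_zero, mul_one]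
      _ = A1 ^ 2 * ∑ p ∈ s, (p : ℝ) ^ (-(1 + η)) := (mul_sum _ _ _).symm
      _ ≤ A1 ^ 2 * K := by
          gcongr
          exact hKsum.sum_le_tsum s fun n _ => by positivity
  have hFsum : ∑ p ∈ s, F p ≤ ∑ p ∈ s, f p / (p : ℝ) + 2 * A1 * L ^ β * R := by
    have hprime : s ⊆ (Icc 1 ⌊y⌋₊).filter Nat.Prime :=
      monotone_filter_right _ fun p _ hp => hp.1
    calc ∑ p ∈ s, F p
        ≤ ∑ p ∈ s, (f p / (p : ℝ)
            + A1 * L ^ β * ((R ^ (Real.log p / Real.log y) - 1) / p)) := by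
          refine sum_le_sum fun p hp => ?_
          have h1 : f p ≤ A1 * L ^ β := by simpa using hfp p (hsp p hp) 1 le_rfl
          have h2 : 0 ≤ ((p : ℝ) ^ δ - 1) / p :=
            div_nonneg (sub_nonneg.2 (Real.one_le_rpow
              (by exact_mod_cast (hsp p hp).one_le) hδ0)) (hs0 p hp).le
          have h3 : F p = f p / p + f p * (((p : ℝ) ^ δ - 1) / p) := by
            simp only [hF]
            rw [Real.rpow_sub_one (hs0 p hp).ne']
            ring
          rw [h3, ← hpδ p (hsp p hp)]
          gcongr
      _ = ∑ p ∈ s, f p / (p : ℝ)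
          + A1 * L ^ β * ∑ p ∈ s, (R ^ (Real.log p / Real.log y) - 1) / p := by
          rw [sum_add_distrib, mul_sum]
      _ ≤ ∑ p ∈ s, f p / (p : ℝ) + A1 * L ^ β * (2 * R) := by
          gcongr
          exact sum_rpow_log_div_log_sub_one_div_le hy1 hlog4 hR1 hprime
      _ = _ := by ring
  refine Real.tsum_le_of_sum_le (fun n => ?_) fun T => ?_
  · dsimp only [Pi.zero_apply]
    split_ifs
    · exact div_nonneg (hf0 n) n.cast_nonneg
    · exact le_rfl
  rw [← sum_filter]
  have hn0 : ∀ n : ℕ, z ^ ((2 : ℝ)⁻¹) ≤ (n : ℝ) → (0 : ℝ) < n := fun n hn =>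
    (Real.rpow_pos_of_pos hz0 _).trans_le hn
  calc _ ≤ ∑ n ∈ T.filter (fun n : ℕ => z ^ ((2 : ℝ)⁻¹) ≤ (n : ℝ) ∧ Nat.Coprime n k ∧
            JRough J n ∧ (∀ p ∈ n.primeFactors, (p : ℝ) ≤ y)),
          Real.exp (-(1 / 2) * γ * r * Real.log r) * F n := by
        refine sum_le_sum fun n hn => ?_
        have hnz := (mem_filter.mp hn).2.1
        have hnpos := hn0 n hnz
        have h1 : Real.exp (1 / 2 * γ * r * Real.log r) ≤ (n : ℝ) ^ δ := by
          calc Real.exp (1 / 2 * γ * r * Real.log r) = (z ^ ((2 : ℝ)⁻¹)) ^ δ := by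
                rw [← Real.rpow_mul hz0.le, Real.rpow_def_of_pos hz0]
                congr 1
                linear_combination (-1 / 2 : ℝ) * hδz
            _ ≤ (n : ℝ) ^ δ := by gcongr
        have h2 : 1 ≤ Real.exp (-(1 / 2) * γ * r * Real.log r) * (n : ℝ) ^ δ := by
          calc (1 : ℝ) = Real.exp (-(1 / 2) * γ * r * Real.log r)
                * Real.exp (1 / 2 * γ * r * Real.log r) := by
                rw [← Real.exp_add, ← Real.exp_zero]
                congr 1
                ring
            _ ≤ _ := by gcongr
        simp only [hF]
        rw [Real.rpow_sub_one hnpos.ne']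
        calc f n / n = f n / n * 1 := (mul_one _).symm
          _ ≤ f n / n * (Real.exp (-(1 / 2) * γ * r * Real.log r) * (n : ℝ) ^ δ) :=
              mul_le_mul_of_nonneg_left h2 (div_nonneg (hf0 n) hnpos.le)
          _ = _ := by ring
    _ ≤ Real.exp (-(1 / 2) * γ * r * Real.log r)
          * Real.exp (∑ p ∈ s, (F p + 2 * q p ^ 2)) := by
        rw [← mul_sum]
        gcongr
        refine sum_factoredNumbers_le_exp hsp
          (fun n => mul_nonneg (hf0 n) (Real.rpow_nonneg n.cast_nonneg _)) (by simp [hF, hf1])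
          (fun m n hmn => ?_) (fun p _ => by simp only [hq]; positivity) hqhalf hFq fun n hn => ?_
        · simp only [hF]
          rw [hfmul m n hmn, Nat.cast_mul, Real.mul_rpow m.cast_nonneg n.cast_nonneg]
          ring
        · obtain ⟨hnz, hnk, hnJ, hny⟩ := (mem_filter.mp hn).2
          have hne : n ≠ 0 := by exact_mod_cast (hn0 n hnz).ne'
          refine Nat.mem_factoredNumbers_of_primeFactors_subset hne fun p hp => ?_
          have hpp := Nat.prime_of_mem_primeFactors hp
          refine mem_filter.2 ⟨mem_Icc.2 ⟨hpp.one_le, Nat.le_floor (hny p hp)⟩, hpp, hnJ p hp, ?_⟩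
          exact fun hpk => hpp.one_lt.ne'
            (Nat.eq_one_of_dvd_coprimes hnk (Nat.dvd_of_mem_primeFactors hp) hpk)
    _ ≤ _ := by
        rw [← Real.exp_add, ← Real.exp_add, sum_add_distrib, ← mul_sum]
        exact Real.exp_le_exp.2 (by linarith)
end
end
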